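/- arXiv:1812.04050 — 5 statements merged into one kernel-verified Lean document; each statement's English description precedes it below -/
import Mathlib

section
/- Let n be divisible by 6. Let w ∈ {a,b}* be a word with |Sw| = 1 in ℬ_n whose switch count is minimal among all such words, and which is shortest among all such words of minimal switch count. Let v be the longest prefix of w such that μ(Sv) = 1. Then b(ab)^{n/3 − 1} is a prefix of v; in particular |v|_s ≥ (2/3)n − 1. -/
/-- The switch count of a word: the number of maximal blocks of consecutive
equal symbols. -/
def swc {σ : Type*} [DecidableEq σ] : List σ → ℕ
  | [] => 0
  | [_] => 1
  | a :: b :: w => (if a = b then 0 else 1) + swc (b :: w)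

/-- Transitions of the automaton `ℬ_n` on the positive states `1,…,n`.
The symbols are booleans: `false` is `a`, `true` is `b`. -/
def BposStep (n : ℕ) (q : ℤ) (s : Bool) : ℤ :=
  if s then
    (if q = 1 then 2 else if q = (n : ℤ) then -((n : ℤ) / 3)
      else if q % 2 = 0 then q - 1 else q + 1)
  else
    (if q = 1 then -1 else if q = (n : ℤ) then -((n : ℤ) / 3)
      else if q % 2 = 0 then q + 1 else q - 1)

/-- Transitions of the auxiliary automaton `ℬ_n`, with state set
`{-n,…,-1} ∪ {1,…,n}` inside `ℤ` and symbols `false` (= `a`), `true` (= `b`);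
negative states move symmetrically: `(-q)s = -(qs)`. -/
def Bstep (n : ℕ) (q : ℤ) (s : Bool) : ℤ :=
  if 0 < q then BposStep n q s else -(BposStep n (-q) s)

/-- The state reached from `q` after reading the word `w` in `ℬ_n`. -/
def Bact (n : ℕ) (q : ℤ) (w : List Bool) : ℤ := w.foldl (Bstep n) q

/-- The image of a set of states of `ℬ_n` under the action of a word. -/
def BactSet (n : ℕ) (A : Set ℤ) (w : List Bool) : Set ℤ :=
  (fun q => Bact n q w) '' A

/-- The set `S = {2k : 1 ≤ k ≤ n/2} ∪ {-(2k-1) : 1 ≤ k ≤ n/2}`. -/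
def SetS (n : ℕ) : Set ℤ :=
  {q | (0 < q ∧ q ≤ (n : ℤ) ∧ q % 2 = 0) ∨ (-(n : ℤ) < q ∧ q < 0 ∧ q % 2 = 1)}

/-- The cycle `C = [-n/3 + 1, n]`, the interval in `S` of states `q` with
`-n/3 + 1 ≤ q ≤ n`. -/
def SetC (n : ℕ) : Set ℤ := {q ∈ SetS n | -((n : ℤ) / 3) + 1 ≤ q}

/-- The action of the word `ab` in `ℬ_n`. -/
def rotAB (n : ℕ) (q : ℤ) : ℤ := Bstep n (Bstep n q false) true

/-- `p ≃ q` iff `p(ab)^{n/3} = q(ab)^{n/3}`. -/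
def simeqB (n : ℕ) (p q : ℤ) : Prop :=
  (rotAB n)^[n / 3] p = (rotAB n)^[n / 3] q

/-- Distance from `p` to `q` for `p, q ∈ S`: the least `k ≥ 1` with
`p(ab)^{n/3 + k} = q(ab)^{n/3}`. -/
noncomputable def dpos (n : ℕ) (p q : ℤ) : ℕ :=
  sInf {k : ℕ | 1 ≤ k ∧ (rotAB n)^[n / 3 + k] p = (rotAB n)^[n / 3] q}

open Classical in
/-- Distance between states of `ℬ_n`: for `p, q ∈ S` it is `dpos`, for
`p, q ∈ -S` it is defined by `d(p,q) = d(-q,-p)`. -/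
noncomputable def dB (n : ℕ) (p q : ℤ) : ℕ :=
  if p ∈ SetS n then dpos n p q else dpos n (-q) (-p)

/-- The measure `μ(A) = max_{p ∈ A} min_{q ∈ A} d(p,q)`. -/
noncomputable def muB (n : ℕ) (A : Set ℤ) : ℕ :=
  sSup ((fun p => sInf ((fun q => dB n p q) '' A)) '' A)

/-- The increasing enumeration of `SetS (6 * k)` by the indices `0, …, 6 * k - 1`. -/
def SIdx (k : ℕ) (i : ℤ) : ℤ :=
  if i < 3 * k then 2 * i - (6 * k - 1) else 2 * i - 6 * k + 2

/-- The set of states with sign `ε` and indices in `I`. -/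
def SImg (k : ℕ) (ε : ℤ) (I : Set ℤ) : Set ℤ := (fun i => ε * SIdx k i) '' I

/-- The action of a symbol on indices, up to a change of sign. -/
def idxStep (k : ℕ) (s : Bool) (i : ℤ) : ℤ :=
  if i = 6 * k - 1 then 4 * k - 1 else if s then 6 * k - 1 - i else 6 * k - 2 - i

/-- The word `b(ab)^t`. -/
def sweepWord (t : ℕ) : List Bool := true :: (List.replicate t [false, true]).flatten

section Words

theorem swc_append_cons_cons {σ : Type*} [DecidableEq σ] (u w : List σ) (x y : σ) :
    swc (u ++ x :: y :: w) + (if x = y then 1 else 0) = swc (u ++ [x]) + swc (y :: w) := by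
  induction u with
  | nil => by_cases h : x = y <;> simp [swc, h]; omega
  | cons z u ih =>
    cases u with
    | nil => simp only [List.cons_append, List.nil_append, swc] at ih ⊢; omega
    | cons z' u => simp only [List.cons_append, swc] at ih ⊢; omega

theorem swc_concat_concat {σ : Type*} [DecidableEq σ] (u : List σ) (x y : σ) :
    swc (u ++ [x] ++ [y]) = swc (u ++ [x]) + (if x = y then 0 else 1) := by
  have h := swc_append_cons_cons u [] x y
  simp only [swc, List.append_assoc, List.cons_append, List.nil_append] at h ⊢
  split_ifs at h ⊢ <;> omega

theorem swc_le_length {σ : Type*} [DecidableEq σ] : ∀ u : List σ, swc u ≤ u.length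
  | [] => by simp [swc]
  | [_] => by simp [swc]
  | a :: b :: w => by
    have := swc_le_length (b :: w)
    simp only [swc, List.length_cons] at this ⊢
    split_ifs <;> omega

theorem sweepWord_succ (t : ℕ) : sweepWord (t + 1) = true :: false :: sweepWord t := by
  simp [sweepWord, List.replicate_succ]

theorem sweepWord_succ' (t : ℕ) : sweepWord (t + 1) = sweepWord t ++ [false] ++ [true] := by
  simp [sweepWord, List.replicate_succ']

theorem length_sweepWord (t : ℕ) : (sweepWord t).length = 2 * t + 1 := by
  induction t with
  | zero => simp [sweepWord]
  | succ t ih => simp [sweepWord_succ, ih]; ring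

theorem exists_sweepWord_eq_concat (t : ℕ) : ∃ u, sweepWord t = u ++ [true] := by
  cases t with
  | zero => exact ⟨[], rfl⟩
  | succ t => exact ⟨_, sweepWord_succ' t⟩

theorem eq_sweepWord (t : ℕ) (v : List Bool) (hl : v.length = 2 * t + 1)
    (hs : swc v = 2 * t + 1) (hlast : v.getLast? = some true) : v = sweepWord t := by
  induction t generalizing v with
  | zero =>
    obtain ⟨x, rfl⟩ := List.length_eq_one_iff.1 hl
    simpa [sweepWord] using hlast
  | succ t ih =>
    match v, hl, hs, hlast with
    | x :: y :: z :: v, hl, hs, hlast =>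
      have h1 := swc_le_length (z :: v)
      simp only [swc, List.length_cons] at hs hl h1
      have hzv : z :: v = sweepWord t := by
        refine ih _ (by simp only [List.length_cons]; omega) ?_ (by simpa using hlast)
        split_ifs at hs <;> omega
      have hz : z = true := by
        have := congrArg List.head? hzv
        simpa [sweepWord] using this
      rw [sweepWord_succ, ← hzv]
      subst hz
      cases x <;> cases y <;> simp at hs ⊢ <;> omega

theorem swc_sweepWord_append (t : ℕ) (w : List Bool) :
    swc (sweepWord t ++ true :: w) = 2 * t + swc (true :: w) := by
  induction t with
  | zero => simp [sweepWord, swc]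
  | succ t ih =>
    rw [sweepWord_succ]
    have : sweepWord t ++ true :: w = true :: ((List.replicate t [false, true]).flatten
        ++ true :: w) := rfl
    rw [this] at ih
    simp only [List.cons_append, this, swc, ih]
    simp; omega

end Words

section Action

theorem BactSet_append (n : ℕ) (A : Set ℤ) (u v : List Bool) :
    BactSet n A (u ++ v) = (fun q => Bact n q v) '' BactSet n A u := by
  simp [BactSet, Bact, Set.image_image, List.foldl_append]

theorem BactSet_concat (n : ℕ) (A : Set ℤ) (u : List Bool) (s : Bool) :
    BactSet n A (u ++ [s]) = (fun q => Bstep n q s) '' BactSet n A u :=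
  BactSet_append n A u [s]

theorem Bstep_neg (n : ℕ) {q : ℤ} (hq : q ≠ 0) (s : Bool) :
    Bstep n (-q) s = -Bstep n q s := by
  unfold Bstep
  rcases lt_or_gt_of_ne hq with h | h
  · rw [if_pos (by omega), if_neg (by omega), neg_neg]
  · rw [if_neg (by omega), if_pos (by omega), neg_neg]

theorem Bstep_ne_zero {n : ℕ} (hn : 3 ≤ n) (q : ℤ) (s : Bool) :
    Bstep n q s ≠ 0 := by
  unfold Bstep BposStep
  split_ifs <;> omega

theorem Bact_neg {n : ℕ} (hn : 3 ≤ n) (w : List Bool) {q : ℤ} (hq : q ≠ 0) :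
    Bact n (-q) w = -Bact n q w := by
  induction w generalizing q with
  | nil => rfl
  | cons s w ih =>
    have := ih (Bstep_ne_zero hn q s)
    simpa [Bact, Bstep_neg n hq] using this

variable {k : ℕ}

theorem SIdx_ne_zero (i : ℤ) : SIdx k i ≠ 0 := by
  unfold SIdx; split_ifs <;> omega

theorem SIdx_injective : Function.Injective (SIdx k) := by
  intro i j h
  unfold SIdx at h
  split_ifs at h <;> omega

theorem SIdx_mem {i : ℤ} (h0 : 0 ≤ i) (h1 : i ≤ 6 * k - 1) : SIdx k i ∈ SetS (6 * k) := by
  simp only [SIdx, SetS, Set.mem_ofPred_eq]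
  push_cast
  split_ifs <;> omega

theorem neg_SIdx_notMem (i : ℤ) : -SIdx k i ∉ SetS (6 * k) := by
  simp only [SIdx, SetS, Set.mem_ofPred_eq]
  push_cast
  split_ifs <;> omega

theorem SetS_eq_SImg : SetS (6 * k) = SImg k 1 (Set.Icc 0 (6 * k - 1)) := by
  ext x
  simp only [SImg, one_mul, Set.mem_image, Set.mem_Icc]
  constructor
  · intro hx
    simp only [SetS, Set.mem_ofPred_eq] at hx
    push_cast at hx
    rcases hx with hx | hx
    · exact ⟨(x + 6 * k - 2) / 2, by omega, by unfold SIdx; split_ifs <;> omega⟩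
    · exact ⟨(x + 6 * k - 1) / 2, by omega, by unfold SIdx; split_ifs <;> omega⟩
  · rintro ⟨i, ⟨h0, h1⟩, rfl⟩
    exact SIdx_mem h0 h1

theorem idxStep_mem (s : Bool) {i : ℤ} (hi : i ∈ Set.Icc (0 : ℤ) (6 * k - 1)) :
    idxStep k s i ∈ Set.Icc (0 : ℤ) (6 * k - 1) := by
  simp only [Set.mem_Icc, idxStep] at hi ⊢
  split_ifs <;> omega

theorem Bstep_SIdx (s : Bool) {i : ℤ} (h0 : 0 ≤ i) (h1 : i ≤ 6 * k - 1) :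
    Bstep (6 * k) (SIdx k i) s = -SIdx k (idxStep k s i) := by
  unfold Bstep BposStep SIdx idxStep
  push_cast
  cases s <;> simp only [if_true, Bool.false_eq_true, if_false] <;> split_ifs <;> omega

theorem image_Bstep_SImg (s : Bool) {ε : ℤ} (hε : ε = 1 ∨ ε = -1) {I : Set ℤ}
    (hI : I ⊆ Set.Icc 0 (6 * k - 1)) :
    (fun q => Bstep (6 * k) q s) '' SImg k ε I = SImg k (-ε) (idxStep k s '' I) := by
  simp only [SImg, Set.image_image]
  refine Set.image_congr fun i hi => ?_
  obtain ⟨h0, h1⟩ := hI hi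
  rcases hε with rfl | rfl
  · simp [Bstep_SIdx s h0 h1]
  · simp [Bstep_neg _ (SIdx_ne_zero i), Bstep_SIdx s h0 h1]

theorem exists_BactSet_eq_SImg (u : List Bool) :
    ∃ ε I, (ε = 1 ∨ ε = -1) ∧ I ⊆ Set.Icc (0 : ℤ) (6 * k - 1) ∧
      BactSet (6 * k) (SetS (6 * k)) u = SImg k ε I := by
  induction u using List.reverseRecOn with
  | nil => exact ⟨1, _, Or.inl rfl, subset_rfl, by simp [BactSet, Bact, ← SetS_eq_SImg]⟩
  | append_singleton u s ih =>
    obtain ⟨ε, I, hε, hI, h⟩ := ih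
    refine ⟨-ε, idxStep k s '' I, by omega, ?_, ?_⟩
    · rintro _ ⟨i, hi, rfl⟩
      exact idxStep_mem s (hI hi)
    · rw [BactSet_concat, h, image_Bstep_SImg s hε hI]

end Action

section Measure

variable {k : ℕ}

theorem rotAB_iterate_SIdx {i : ℤ} (h0 : 0 ≤ i) (h1 : i ≤ 6 * k - 1) (t : ℕ) :
    (rotAB (6 * k))^[t] (SIdx k i) =
      SIdx k (if i + t < 2 * k then i + t else 2 * k + (i + t - 2 * k) % (4 * k)) := by
  have hk : (0 : ℤ) < 4 * k := by omega
  induction t with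
  | zero =>
    rw [Function.iterate_zero, id]
    congr 1
    split_ifs with h
    · simp
    · rw [Int.emod_eq_of_lt] <;> push_cast at * <;> omega
  | succ t ih =>
    rw [Function.iterate_succ_apply', ih]
    set j := if i + t < 2 * k then i + (t : ℤ) else 2 * k + (i + t - 2 * k) % (4 * k) with hj
    have hm0 := Int.emod_nonneg (i + t - 2 * k) hk.ne'
    have hm1 := Int.emod_lt_of_pos (i + t - 2 * k) hk
    have hj0 : 0 ≤ j ∧ j ≤ 6 * k - 1 := by rw [hj]; split_ifs <;> omega
    have hj' := idxStep_mem (k := k) false (i := j) hj0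
    have hrot : rotAB (6 * k) (SIdx k j) = SIdx k (if j = 6 * k - 1 then 2 * k else j + 1) := by
      rw [rotAB, Bstep_SIdx _ hj0.1 hj0.2, Bstep_neg _ (SIdx_ne_zero _),
        Bstep_SIdx _ hj'.1 hj'.2, neg_neg]
      congr 1
      simp only [idxStep, if_true, Bool.false_eq_true, if_false]
      split_ifs <;> omega
    rw [hrot]
    congr 1
    have hstep : (i + t - 2 * k + 1) % (4 * k) =
        if (i + t - 2 * k) % (4 * k) = 4 * k - 1 then 0 else (i + t - 2 * k) % (4 * k) + 1 := by
      rw [Int.add_emod]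
      rcases eq_or_lt_of_le (show (1 : ℤ) ≤ 4 * k by omega) with h | h
      · omega
      rw [Int.emod_eq_of_lt (a := 1) (by omega) h]
      split_ifs with h
      · rw [h]; simp
      · exact Int.emod_eq_of_lt (by omega) (by omega)
    have hcast : i + ((t + 1 : ℕ) : ℤ) - 2 * k = i + t - 2 * k + 1 := by push_cast; ring
    rw [hcast, hstep]
    have hz : i + t + 1 = 2 * k → (i + t - 2 * k + 1) % (4 * k) = 0 := fun h => by
      rw [show i + t - 2 * k + 1 = 0 by omega]; simp
    rw [hstep] at hz
    rw [hj]
    push_cast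
    split_ifs at * <;> omega

theorem rotAB_iterate_eq_iff {i j : ℤ} (hi : i ∈ Set.Icc (0 : ℤ) (6 * k - 1))
    (hj : j ∈ Set.Icc (0 : ℤ) (6 * k - 1)) (d : ℕ) :
    (rotAB (6 * k))^[6 * k / 3 + d] (SIdx k i) = (rotAB (6 * k))^[6 * k / 3] (SIdx k j) ↔
      (4 * k : ℤ) ∣ j - i - d := by
  have h3 : 6 * k / 3 = 2 * k := by omega
  simp only [Set.mem_Icc] at hi hj
  rw [rotAB_iterate_SIdx hi.1 hi.2, rotAB_iterate_SIdx hj.1 hj.2, SIdx_injective.eq_iff, h3,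
    if_neg (by push_cast; omega), if_neg (by push_cast; omega), add_right_inj,
    Int.emod_eq_emod_iff_emod_sub_eq_zero, ← Int.dvd_iff_emod_eq_zero, ← dvd_neg]
  push_cast
  ring_nf

theorem one_le_dpos_and_eq_one_iff (hk : 1 ≤ k) {i j : ℤ} (hi : i ∈ Set.Icc (0 : ℤ) (6 * k - 1))
    (hj : j ∈ Set.Icc (0 : ℤ) (6 * k - 1)) :
    1 ≤ dpos (6 * k) (SIdx k i) (SIdx k j) ∧
      (dpos (6 * k) (SIdx k i) (SIdx k j) = 1 ↔ (4 * k : ℤ) ∣ j - i - 1) := by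
  simp only [dpos, rotAB_iterate_eq_iff hi hj]
  have hne : {d : ℕ | 1 ≤ d ∧ (4 * k : ℤ) ∣ j - i - d}.Nonempty := by
    refine ⟨((j - i - 1) % (4 * k)).toNat + 1, by simp, ?_⟩
    have h0 := Int.emod_nonneg (j - i - 1) (show (4 * k : ℤ) ≠ 0 by omega)
    have := Int.dvd_self_sub_emod (x := j - i - 1) (m := 4 * k)
    push_cast
    rw [Int.toNat_of_nonneg h0]
    convert this using 1
    ring
  have hmem := Nat.sInf_mem hne
  refine ⟨hmem.1, fun h => ?_, fun h => ?_⟩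
  · rw [h] at hmem
    exact_mod_cast hmem.2
  · exact le_antisymm (Nat.sInf_le ⟨le_rfl, by exact_mod_cast h⟩) hmem.1

theorem one_le_dB_and_eq_one_iff (hk : 1 ≤ k) {ε : ℤ} (hε : ε = 1 ∨ ε = -1) {i j : ℤ}
    (hi : i ∈ Set.Icc (0 : ℤ) (6 * k - 1)) (hj : j ∈ Set.Icc (0 : ℤ) (6 * k - 1)) :
    1 ≤ dB (6 * k) (ε * SIdx k i) (ε * SIdx k j) ∧
      (dB (6 * k) (ε * SIdx k i) (ε * SIdx k j) = 1 ↔ (4 * k : ℤ) ∣ j - i - ε) := by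
  rcases hε with rfl | rfl
  · simp only [one_mul]
    rw [dB, if_pos (SIdx_mem hi.1 hi.2)]
    exact one_le_dpos_and_eq_one_iff hk hi hj
  · simp only [neg_one_mul]
    rw [dB, if_neg (neg_SIdx_notMem i), neg_neg, neg_neg]
    have h := one_le_dpos_and_eq_one_iff hk hj hi
    rwa [← dvd_neg, show -(i - j - 1) = j - i - -1 by ring] at h

theorem sSup_sInf_eq_one_iff {α : Type*} {A : Set α} (hfin : A.Finite) (hne : A.Nonempty)
    (d : α → α → ℕ) (hd : ∀ p ∈ A, ∀ q ∈ A, 1 ≤ d p q) :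
    sSup ((fun p => sInf ((fun q => d p q) '' A)) '' A) = 1 ↔ ∀ p ∈ A, ∃ q ∈ A, d p q = 1 := by
  have hmem (p : α) : sInf ((fun q => d p q) '' A) ∈ (fun q => d p q) '' A :=
    Nat.sInf_mem (hne.image _)
  constructor
  · intro h p hp
    obtain ⟨q, hq, hpq⟩ := hmem p
    have hle := le_csSup (hfin.image fun p => sInf ((fun q => d p q) '' A)).bddAbove
      (Set.mem_image_of_mem _ hp)
    have h1 := hd p hp q hq
    exact ⟨q, hq, by simp only at hpq hle; omega⟩
  · intro h
    have hone : ∀ p ∈ A, sInf ((fun q => d p q) '' A) = 1 := by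
      intro p hp
      obtain ⟨q, hq, hpq⟩ := h p hp
      obtain ⟨q', hq', hpq'⟩ := hmem p
      have h1 := hd p hp q' hq'
      have h2 := Nat.sInf_le (Set.mem_image_of_mem (fun q => d p q) hq)
      simp only at hpq' h2
      omega
    rw [Set.image_congr hone, hne.image_const, csSup_singleton]

theorem muB_SImg_eq_one_iff (hk : 1 ≤ k) {ε : ℤ} (hε : ε = 1 ∨ ε = -1) {I : Set ℤ}
    (hI : I ⊆ Set.Icc 0 (6 * k - 1)) (hne : I.Nonempty) :
    muB (6 * k) (SImg k ε I) = 1 ↔ ∀ i ∈ I, ∃ j ∈ I, (4 * k : ℤ) ∣ j - i - ε := by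
  have hfin : (SImg k ε I).Finite := ((Set.finite_Icc _ _).subset hI).image _
  rw [muB, sSup_sInf_eq_one_iff hfin (hne.image _)]
  · simp only [SImg, Set.forall_mem_image, Set.exists_mem_image]
    refine forall₂_congr fun i hi => exists_congr fun j => and_congr_right fun hj => ?_
    exact (one_le_dB_and_eq_one_iff hk hε (hI hi) (hI hj)).2
  · rintro _ ⟨i, hi, rfl⟩ _ ⟨j, hj, rfl⟩
    exact (one_le_dB_and_eq_one_iff hk hε (hI hi) (hI hj)).1

theorem muB_SImg_Icc (hk : 1 ≤ k) {ε : ℤ} (hε : ε = 1 ∨ ε = -1) {p q : ℤ} (hp : 0 ≤ p)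
    (hq : q ≤ 6 * k - 1) (hpq : 4 * k - 1 ≤ q - p) :
    muB (6 * k) (SImg k ε (Set.Icc p q)) = 1 := by
  rw [muB_SImg_eq_one_iff hk hε (Set.Icc_subset_Icc hp hq) ⟨p, by simp; omega⟩]
  rintro i ⟨h1, h2⟩
  by_cases hi : i + ε ∈ Set.Icc p q
  · exact ⟨i + ε, hi, by simp⟩
  · refine ⟨i + ε - ε * (4 * k), ?_, ⟨-ε, by ring⟩⟩
    simp only [Set.mem_Icc] at hi ⊢
    rcases hε with rfl | rfl <;> omega

theorem four_mul_le_ncard_of_muB_eq_one (hk : 1 ≤ k) {ε : ℤ} (hε : ε = 1 ∨ ε = -1) {I : Set ℤ}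
    (hI : I ⊆ Set.Icc 0 (6 * k - 1)) (hmu : muB (6 * k) (SImg k ε I) = 1) :
    4 * k ≤ (SImg k ε I).ncard := by
  have hne : I.Nonempty := by
    by_contra h
    rw [Set.not_nonempty_iff_eq_empty] at h
    simp [h, muB, SImg] at hmu
  rw [muB_SImg_eq_one_iff hk hε hI hne] at hmu
  obtain ⟨i, hi⟩ := hne
  have hex : ∀ t : ℕ, ∃ j ∈ I, (4 * k : ℤ) ∣ j - i - ε * t := by
    intro t
    induction t with
    | zero => exact ⟨i, hi, by simp⟩
    | succ t ih =>
      obtain ⟨j, hj, hd⟩ := ih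
      obtain ⟨j', hj', hd'⟩ := hmu j hj
      refine ⟨j', hj', ?_⟩
      have h := dvd_add hd hd'
      rwa [show j - i - ε * t + (j' - j - ε) = j' - i - ε * (t + 1 : ℕ) by push_cast; ring] at h
  choose g hgI hg using hex
  have hfin : (SImg k ε I).Finite := ((Set.finite_Icc _ _).subset hI).image _
  rw [Set.ncard_eq_toFinset_card _ hfin, ← Finset.card_range (4 * k)]
  refine Finset.card_le_card_of_injOn (fun t => ε * SIdx k (g t)) ?_ ?_
  · intro t _
    rw [Set.Finite.coe_toFinset]
    exact Set.mem_image_of_mem _ (hgI t)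
  · intro t ht t' ht' h
    have hε0 : ε ≠ 0 := by omega
    have hgg : g t = g t' := SIdx_injective (mul_left_cancel₀ hε0 h)
    have hd := dvd_sub (hg t') (hg t)
    rw [hgg, show g t' - i - ε * t' - (g t' - i - ε * t) = ε * (t - t') by ring] at hd
    have hd' : (4 * k : ℤ) ∣ t - t' := by
      rcases hε with rfl | rfl
      · simpa using hd
      · rw [← dvd_neg]; simpa using hd
    simp only [Finset.coe_range, Set.mem_Iio] at ht ht'
    have := Int.eq_zero_of_abs_lt_dvd hd' (by rw [abs_lt]; constructor <;> omega)
    omega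

end Measure

section Sweep

variable {k : ℕ}

/-- Lower bounds for the switch count `c` of a word with last symbol `s` that maps `SetS (6 * k)`
to the set of states of indices between `p` and `q`, up to sign. -/
def SwcBound (k : ℕ) (p q : ℤ) (c : ℕ) : Option Bool → Prop
  | none => p = 0 ∧ q = 6 * k - 1 ∧ c = 0
  | some true => 1 ≤ c ∧ 2 * p - 1 ≤ c ∧ 2 * (6 * k - 1 - q) - 1 ≤ c
  | some false => 1 ≤ c ∧ 2 * p ≤ c ∧ 2 * (6 * k - 1 - q) - 2 ≤ c

theorem image_idxStep_true_of_lt {p q : ℤ} (hq : q < 6 * k - 1) :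
    idxStep k true '' Set.Icc p q = Set.Icc (6 * k - 1 - q) (6 * k - 1 - p) := by
  ext x
  simp only [Set.mem_image, Set.mem_Icc, idxStep, if_true]
  constructor
  · rintro ⟨i, hi, rfl⟩
    split_ifs <;> omega
  · exact fun hx => ⟨6 * k - 1 - x, by omega, by split_ifs <;> omega⟩

theorem image_idxStep_false_of_lt {p q : ℤ} (hq : q < 6 * k - 1) :
    idxStep k false '' Set.Icc p q = Set.Icc (6 * k - 2 - q) (6 * k - 2 - p) := by
  ext x
  simp only [Set.mem_image, Set.mem_Icc, idxStep, Bool.false_eq_true, if_false]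
  constructor
  · rintro ⟨i, hi, rfl⟩
    split_ifs <;> omega
  · exact fun hx => ⟨6 * k - 2 - x, by omega, by split_ifs <;> omega⟩

theorem image_idxStep_true_last (hk : 1 ≤ k) {p : ℤ} (hp : p < 2 * k) :
    idxStep k true '' Set.Icc p (6 * k - 1) = Set.Icc 1 (6 * k - 1 - p) := by
  ext x
  simp only [Set.mem_image, Set.mem_Icc, idxStep, if_true]
  constructor
  · rintro ⟨i, hi, rfl⟩
    split_ifs <;> omega
  · exact fun hx => ⟨6 * k - 1 - x, by omega, by split_ifs <;> omega⟩

theorem image_idxStep_false_last (hk : 1 ≤ k) {p : ℤ} (hp : p < 2 * k) :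
    idxStep k false '' Set.Icc p (6 * k - 1) = Set.Icc 0 (6 * k - 2 - p) := by
  ext x
  simp only [Set.mem_image, Set.mem_Icc, idxStep, Bool.false_eq_true, if_false]
  constructor
  · rintro ⟨i, hi, rfl⟩
    split_ifs <;> omega
  · exact fun hx => ⟨6 * k - 2 - x, by omega, by split_ifs <;> omega⟩

theorem image_idxStep_false_cycle (hk : 1 ≤ k) :
    idxStep k false '' Set.Icc (2 * k : ℤ) (6 * k - 1) = Set.Icc (0 : ℤ) (4 * k - 1) := by
  ext x
  simp only [Set.mem_image, Set.mem_Icc, idxStep, Bool.false_eq_true, if_false]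
  constructor
  · rintro ⟨i, hi, rfl⟩
    split_ifs <;> omega
  · intro hx
    by_cases h : x = 4 * k - 1
    · exact ⟨6 * k - 1, by omega, by simp [h]⟩
    · exact ⟨6 * k - 2 - x, by omega, by split_ifs <;> omega⟩

theorem exists_image_idxStep_Icc (hk : 1 ≤ k) (u : List Bool) (s : Bool) {p q : ℤ} (hp : 0 ≤ p)
    (hq : q ≤ 6 * k - 1) (hpq : 4 * k - 1 ≤ q - p)
    (hb : SwcBound k p q (swc u) u.getLast?) :
    (∃ p' q' : ℤ, 0 ≤ p' ∧ q' ≤ 6 * k - 1 ∧ 4 * k - 1 ≤ q' - p' ∧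
      idxStep k s '' Set.Icc p q = Set.Icc p' q' ∧
      SwcBound k p' q' (swc (u ++ [s])) (some s)) ∨
    (s = true ∧ p = 2 * k ∧ q = 6 * k - 1) := by
  have hsw : swc (u ++ [s]) = swc u + (if u.getLast? = some s then 0 else 1) := by
    rcases List.eq_nil_or_concat' u with rfl | ⟨u, x, rfl⟩
    · simp [swc]
    · rw [swc_concat_concat]; simp
  by_cases hex : s = true ∧ p = 2 * k ∧ q = 6 * k - 1
  · exact Or.inr hex
  left
  generalize swc (u ++ [s]) = c' at hsw ⊢
  generalize swc u = c at hsw hb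
  generalize u.getLast? = l at hsw hb
  rcases eq_or_lt_of_le hq with rfl | hq'
  · rcases eq_or_lt_of_le (show p ≤ 2 * k by omega) with rfl | hp'
    · cases s
      · refine ⟨_, _, ?_, ?_, ?_, image_idxStep_false_cycle hk, ?_⟩ <;> try omega
        rcases l with _ | _ | _ <;> simp [SwcBound] at * <;> omega
      · simp at hex
    · cases s
      · refine ⟨_, _, ?_, ?_, ?_, image_idxStep_false_last hk hp', ?_⟩ <;> try omega
        rcases l with _ | _ | _ <;> simp [SwcBound] at * <;> omega
      · refine ⟨_, _, ?_, ?_, ?_, image_idxStep_true_last hk hp', ?_⟩ <;> try omega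
        rcases l with _ | _ | _ <;> simp [SwcBound] at * <;> omega
  · cases s
    · refine ⟨_, _, ?_, ?_, ?_, image_idxStep_false_of_lt hq', ?_⟩ <;> try omega
      rcases l with _ | _ | _ <;> simp [SwcBound] at * <;> omega
    · refine ⟨_, _, ?_, ?_, ?_, image_idxStep_true_of_lt hq', ?_⟩ <;> try omega
      rcases l with _ | _ | _ <;> simp [SwcBound] at * <;> omega

theorem ncard_image_Bstep_cycle_lt (hk : 1 ≤ k) {ε : ℤ} (hε : ε = 1 ∨ ε = -1) :
    ((fun q => Bstep (6 * k) q true) '' SImg k ε (Set.Icc (2 * k) (6 * k - 1))).ncard < 4 * k := by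
  rw [image_Bstep_SImg true hε (Set.Icc_subset_Icc (by omega) le_rfl)]
  have hsub : idxStep k true '' Set.Icc (2 * k) (6 * k - 1) ⊆ Finset.Icc (1 : ℤ) (4 * k - 1) := by
    rintro _ ⟨i, ⟨h1, h2⟩, rfl⟩
    simp only [Finset.coe_Icc, Set.mem_Icc, idxStep, if_true]
    split_ifs <;> omega
  have h1 := Set.ncard_le_ncard hsub (Finset.finite_toSet _)
  have h2 := Set.ncard_image_le (f := fun i => -ε * SIdx k i)
    ((Finset.finite_toSet _).subset hsub)
  rw [Set.ncard_coe_finset, Int.card_Icc] at h1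
  rw [SImg]
  omega

theorem finite_BactSet (u : List Bool) : (BactSet (6 * k) (SetS (6 * k)) u).Finite := by
  obtain ⟨ε, I, -, hI, h⟩ := exists_BactSet_eq_SImg (k := k) u
  rw [h]
  exact ((Set.finite_Icc _ _).subset hI).image _

theorem exists_BactSet_eq_SImg_Icc_or_ncard_lt (hk : 1 ≤ k) (u : List Bool) :
    (∃ ε p q : ℤ, (ε = 1 ∨ ε = -1) ∧ 0 ≤ p ∧ q ≤ 6 * k - 1 ∧ 4 * k - 1 ≤ q - p ∧
      BactSet (6 * k) (SetS (6 * k)) u = SImg k ε (Set.Icc p q) ∧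
      SwcBound k p q (swc u) u.getLast?) ∨
    (BactSet (6 * k) (SetS (6 * k)) u).ncard < 4 * k := by
  induction u using List.reverseRecOn with
  | nil =>
    refine Or.inl ⟨1, 0, 6 * k - 1, Or.inl rfl, le_rfl, le_rfl, by omega, ?_, rfl, rfl, rfl⟩
    simp [BactSet, Bact, ← SetS_eq_SImg]
  | append_singleton u s ih =>
    rcases ih with ⟨ε, p, q, hε, hp, hq, hpq, hu, hb⟩ | h
    · rcases exists_image_idxStep_Icc hk u s hp hq hpq hb with
        ⟨p', q', hp', hq', hpq', him, hb'⟩ | ⟨rfl, rfl, rfl⟩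
      · refine Or.inl ⟨-ε, p', q', by omega, hp', hq', hpq', ?_, by simpa using hb'⟩
        rw [BactSet_concat, hu, image_Bstep_SImg s hε (Set.Icc_subset_Icc hp hq), him]
      · right
        rw [BactSet_concat, hu]
        exact ncard_image_Bstep_cycle_lt hk hε
    · right
      rw [BactSet_concat]
      exact (Set.ncard_image_le (finite_BactSet u)).trans_lt h

theorem four_mul_le_ncard_BactSet (hk : 1 ≤ k) {u : List Bool}
    (hmu : muB (6 * k) (BactSet (6 * k) (SetS (6 * k)) u) = 1) :
    4 * k ≤ (BactSet (6 * k) (SetS (6 * k)) u).ncard := by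
  obtain ⟨ε, I, hε, hI, h⟩ := exists_BactSet_eq_SImg (k := k) u
  rw [h] at hmu ⊢
  exact four_mul_le_ncard_of_muB_eq_one hk hε hI hmu

/-- If the measure is one after `u` but not after `us`, then `s = b` and the image under `u` is
the cycle of `ab`, up to sign. -/
theorem BactSet_eq_cycle (hk : 1 ≤ k) {u : List Bool} {s : Bool}
    (hmu : muB (6 * k) (BactSet (6 * k) (SetS (6 * k)) u) = 1)
    (hmu' : muB (6 * k) (BactSet (6 * k) (SetS (6 * k)) (u ++ [s])) ≠ 1) :
    s = true ∧ 4 * k - 1 ≤ swc u ∧ ∃ ε : ℤ, (ε = 1 ∨ ε = -1) ∧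
      BactSet (6 * k) (SetS (6 * k)) u = SImg k ε (Set.Icc (2 * k) (6 * k - 1)) := by
  rcases exists_BactSet_eq_SImg_Icc_or_ncard_lt hk u with
    ⟨ε, p, q, hε, hp, hq, hpq, hu, hb⟩ | h
  · rcases exists_image_idxStep_Icc hk u s hp hq hpq hb with
      ⟨p', q', hp', hq', hpq', him, -⟩ | ⟨rfl, rfl, rfl⟩
    · refine absurd ?_ hmu'
      rw [BactSet_concat, hu, image_Bstep_SImg s hε (Set.Icc_subset_Icc hp hq), him]
      exact muB_SImg_Icc hk (by omega) hp' hq' hpq'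
    · refine ⟨rfl, ?_, ε, hε, hu⟩
      generalize u.getLast? = l at hb
      rcases l with _ | _ | _ <;> simp only [SwcBound] at hb <;> omega
  · exact absurd (four_mul_le_ncard_BactSet hk hmu) (by omega)

theorem BactSet_sweepWord (t : ℕ) (ht : t + 1 ≤ 2 * k) :
    BactSet (6 * k) (SetS (6 * k)) (sweepWord t) = SImg k (-1) (Set.Icc (t + 1) (6 * k - 1)) := by
  induction t with
  | zero =>
    have h : sweepWord 0 = [] ++ [true] := rfl
    have h0 : BactSet (6 * k) (SetS (6 * k)) [] = SImg k 1 (Set.Icc 0 (6 * k - 1)) := by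
      simp [BactSet, Bact, ← SetS_eq_SImg]
    rw [h, BactSet_concat, h0, image_Bstep_SImg true (Or.inl rfl) subset_rfl,
      image_idxStep_true_last (by omega) (by omega)]
    simp
  | succ t ih =>
    rw [sweepWord_succ', BactSet_concat, BactSet_concat, ih (by omega),
      image_Bstep_SImg false (Or.inr rfl) (Set.Icc_subset_Icc (by omega) le_rfl),
      image_idxStep_false_last (by omega) (by omega),
      image_Bstep_SImg true (by simp) (Set.Icc_subset_Icc (by omega) (by omega)),
      image_idxStep_true_of_lt (by omega)]
    push_cast
    congr 2 <;> ring

theorem exists_image_Bact_SImg_neg (hk : 1 ≤ k) {ε : ℤ} (hε : ε = 1 ∨ ε = -1) (I : Set ℤ)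
    (w : List Bool) (h : ∃ x, (fun q => Bact (6 * k) q w) '' SImg k ε I = {x}) :
    ∃ x, (fun q => Bact (6 * k) q w) '' SImg k (-1) I = {x} := by
  rcases hε with rfl | rfl
  · obtain ⟨x, hx⟩ := h
    refine ⟨-x, ?_⟩
    rw [← Set.image_singleton (f := fun x : ℤ => -x), ← hx]
    simp only [SImg, Set.image_image, one_mul, neg_one_mul]
    exact Set.image_congr fun i _ => Bact_neg (by omega) w (SIdx_ne_zero i)
  · exact h

end Sweep

/-- Let `n` be divisible by 6 and let `w` be a word with `|Sw| = 1` in `ℬ_n`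
of minimal switch count, shortest among all such words of minimal switch count.
If `v` is the longest prefix of `w` with `μ(Sv) = 1`, then `b(ab)^{n/3 - 1}` is
a prefix of `v`; in particular `|v|_s ≥ 2n/3 - 1`. -/
theorem prefix_of_min_sync (n : ℕ) (hn : 6 ∣ n) (w v : List Bool)
    (hsync : ∃ x : ℤ, BactSet n (SetS n) w = {x})
    (hminsw : ∀ u : List Bool, (∃ x : ℤ, BactSet n (SetS n) u = {x}) →
      swc w ≤ swc u)
    (hminlen : ∀ u : List Bool, (∃ x : ℤ, BactSet n (SetS n) u = {x}) →
      swc u = swc w → w.length ≤ u.length)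
    (hpre : v <+: w)
    (hmuv : muB n (BactSet n (SetS n) v) = 1)
    (hlongest : ∀ u : List Bool, u <+: w →
      muB n (BactSet n (SetS n) u) = 1 → u.length ≤ v.length) :
    (true :: (List.replicate (n / 3 - 1) [false, true]).flatten) <+: v ∧
      2 * n / 3 - 1 ≤ swc v := by
  obtain ⟨k, rfl⟩ := hn
  rcases Nat.eq_zero_or_pos k with rfl | hk
  · obtain ⟨x, hx⟩ := hsync
    have hS : SetS (6 * 0) = ∅ := by
      rw [SetS_eq_SImg]
      simp [SImg]
    rw [BactSet, hS, Set.image_empty] at hx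
    exact absurd hx.symm (Set.singleton_ne_empty x)
  obtain ⟨w', rfl⟩ := hpre
  cases w' with
  | nil =>
    obtain ⟨x, hx⟩ := hsync
    rw [List.append_nil] at hx
    have := four_mul_le_ncard_BactSet hk hmuv
    rw [hx, Set.ncard_singleton] at this
    omega
  | cons s w' =>
    have hmu' : muB (6 * k) (BactSet (6 * k) (SetS (6 * k)) (v ++ [s])) ≠ 1 := fun h => by
      have := hlongest (v ++ [s]) ⟨w', by simp⟩ h
      simp at this
    obtain ⟨rfl, hsw, ε, hε, hv⟩ := BactSet_eq_cycle hk hmuv hmu'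
    obtain ⟨t, ht⟩ : ∃ t, 2 * k = t + 1 := ⟨2 * k - 1, by omega⟩
    have hcycle : BactSet (6 * k) (SetS (6 * k)) (sweepWord t) =
        SImg k (-1) (Set.Icc (2 * k) (6 * k - 1)) := by
      rw [BactSet_sweepWord t ht.ge]
      congr 2
      omega
    have hsync' : ∃ x, BactSet (6 * k) (SetS (6 * k)) (sweepWord t ++ true :: w') = {x} := by
      rw [BactSet_append, hcycle]
      refine exists_image_Bact_SImg_neg hk hε _ _ ?_
      rwa [← hv, ← BactSet_append]
    obtain ⟨u, y, rfl⟩ : ∃ u y, v = u ++ [y] := by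
      rcases List.eq_nil_or_concat' v with rfl | h
      · simp [swc] at hsw
        omega
      · exact h
    have h1 := hminsw _ hsync'
    have h2 := hminlen _ hsync'
    have h3 := swc_append_cons_cons u w' y true
    have h4 := swc_le_length (u ++ [y])
    rw [swc_sweepWord_append] at h1 h2
    rw [List.append_assoc] at h1 h2
    simp only [List.cons_append, List.nil_append] at h1 h2
    obtain rfl : y = true := by
      by_contra hy
      rw [if_neg hy] at h3
      omega
    rw [if_pos rfl] at h3
    have h5 := h2 (by omega)
    simp only [List.length_append, List.length_cons, length_sweepWord, List.length_nil] at h4 h5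
    have hsweep : u ++ [true] = sweepWord t :=
      eq_sweepWord t _ (by simp; omega) (by omega) (by simp)
    refine ⟨?_, by omega⟩
    rw [hsweep, show 6 * k / 3 - 1 = t by omega]
    exact List.prefix_rfl
end

section
/- Let n be divisible by 6 and let A ⊆ S, acting in ℬ_n. Then μ(Aa) = μ(A) and μ(Ab) ≤ μ(A) + 1. Moreover, if n ∉ A, then μ(Ab) = μ(A). -/
/-- The rank of a state of `S` in increasing order, for `n = 6 * m`. -/
def rankS (m : ℕ) (q : ℤ) : ℤ :=
  if 0 < q then q / 2 + 3 * m - 1 else (q + 6 * m - 1) / 2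

theorem rankS_inj {m : ℕ} {p q : ℤ} (hp : p ∈ SetS (6 * m)) (hq : q ∈ SetS (6 * m))
    (h : rankS m p = rankS m q) : p = q := by
  simp only [SetS, Set.mem_ofPred_eq] at hp hq
  push_cast at hp hq
  unfold rankS at h
  split_ifs at h <;> omega

theorem rankS_lt {m : ℕ} {p : ℤ} (hp : p ∈ SetS (6 * m)) : rankS m p < 6 * m := by
  simp only [SetS, Set.mem_ofPred_eq] at hp
  push_cast at hp
  unfold rankS
  split_ifs <;> omega

theorem rankS_nonneg {m : ℕ} {p : ℤ} (hp : p ∈ SetS (6 * m)) : 0 ≤ rankS m p := by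
  simp only [SetS, Set.mem_ofPred_eq] at hp
  push_cast at hp
  unfold rankS
  split_ifs <;> omega

theorem rotAB_mem_and_rankS {m : ℕ} {p : ℤ} (hp : p ∈ SetS (6 * m)) :
    rotAB (6 * m) p ∈ SetS (6 * m) ∧
      (rankS m (rotAB (6 * m) p) = rankS m p + 1 ∨
        rankS m p = 6 * m - 1 ∧ rankS m (rotAB (6 * m) p) = 2 * m) := by
  simp only [SetS, Set.mem_ofPred_eq] at hp ⊢
  obtain ⟨r, hr⟩ : ∃ r, r = rotAB (6 * m) p := ⟨_, rfl⟩
  obtain ⟨s, hs⟩ : ∃ s, s = Bstep (6 * m) p false := ⟨_, rfl⟩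
  rw [← hr]
  rw [rotAB, ← hs] at hr
  simp only [Bstep, BposStep, Bool.false_eq_true, if_false, if_true] at hr hs
  unfold rankS
  push_cast at *
  rcases hp with hp | hp <;> split_ifs at hs <;> split_ifs at hr <;> split_ifs <;> omega

theorem neg_Bstep_false_mem_and_rankS {m : ℕ} {p : ℤ} (hp : p ∈ SetS (6 * m)) :
    -Bstep (6 * m) p false ∈ SetS (6 * m) ∧
      (rankS m (-Bstep (6 * m) p false) = 6 * m - 2 - rankS m p ∨
        rankS m (-Bstep (6 * m) p false) = 10 * m - 2 - rankS m p) := by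
  simp only [SetS, Set.mem_ofPred_eq] at hp ⊢
  obtain ⟨s, hs⟩ : ∃ s, s = Bstep (6 * m) p false := ⟨_, rfl⟩
  rw [← hs]
  simp only [Bstep, BposStep, Bool.false_eq_true, if_false] at hs
  unfold rankS
  push_cast at *
  rcases hp with hp | hp <;> split_ifs at hs <;> split_ifs <;> omega

theorem neg_Bstep_true_mem {m : ℕ} {p : ℤ} (hp : p ∈ SetS (6 * m)) :
    -Bstep (6 * m) p true ∈ SetS (6 * m) := by
  simp only [SetS, Set.mem_ofPred_eq] at hp ⊢
  obtain ⟨s, hs⟩ : ∃ s, s = Bstep (6 * m) p true := ⟨_, rfl⟩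
  rw [← hs]
  simp only [Bstep, BposStep, if_true] at hs
  push_cast at *
  rcases hp with hp | hp <;> split_ifs at hs <;> omega

theorem rankS_neg_Bstep_true {m : ℕ} {p : ℤ} (hp : p ∈ SetS (6 * m))
    (hpn : p ≠ ((6 * m : ℕ) : ℤ)) :
    rankS m (-Bstep (6 * m) p true) = 6 * m - 1 - rankS m p := by
  simp only [SetS, Set.mem_ofPred_eq] at hp
  obtain ⟨s, hs⟩ : ∃ s, s = Bstep (6 * m) p true := ⟨_, rfl⟩
  rw [← hs]
  simp only [Bstep, BposStep, if_true] at hs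
  unfold rankS
  push_cast at *
  rcases hp with hp | hp <;> split_ifs at hs <;> split_ifs <;> omega

theorem rankS_neg_Bstep_true_self {m : ℕ} (hm : 0 < m) :
    rankS m (-Bstep (6 * m) ((6 * m : ℕ) : ℤ) true) = 10 * m - 2 - rankS m ((6 * m : ℕ) : ℤ) := by
  obtain ⟨s, hs⟩ : ∃ s, s = Bstep (6 * m) ((6 * m : ℕ) : ℤ) true := ⟨_, rfl⟩
  rw [← hs]
  simp only [Bstep, BposStep, if_true] at hs
  unfold rankS
  push_cast at *
  split_ifs at hs <;> split_ifs <;> omega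

theorem rotAB_iterate {m : ℕ} {p : ℤ} (hp : p ∈ SetS (6 * m)) (k : ℕ) :
    (rotAB (6 * m))^[k] p ∈ SetS (6 * m) ∧
      (4 * m : ℤ) ∣ rankS m ((rotAB (6 * m))^[k] p) - (rankS m p + k) ∧
      (2 * m ≤ rankS m ((rotAB (6 * m))^[k] p) ∨
        rankS m p + k ≤ rankS m ((rotAB (6 * m))^[k] p)) := by
  induction k with
  | zero => simp [hp]
  | succ k ih =>
    rw [Function.iterate_succ_apply']
    obtain ⟨hmem, hdvd, hle⟩ := ih
    obtain ⟨hmem', hrank⟩ := rotAB_mem_and_rankS hmem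
    refine ⟨hmem', ?_, by push_cast; omega⟩
    rcases hrank with h | ⟨h, h'⟩
    · rw [h]
      refine hdvd.trans (dvd_of_eq ?_)
      push_cast
      ring
    · rw [h']
      rw [h] at hdvd
      refine Dvd.dvd.trans (hdvd.sub (dvd_refl (4 * m : ℤ))) (dvd_of_eq ?_)
      push_cast
      ring

theorem rotAB_iterate_eq_iff_s14 {m : ℕ} {p q : ℤ} (hp : p ∈ SetS (6 * m))
    (hq : q ∈ SetS (6 * m)) (k : ℕ) :
    (rotAB (6 * m))^[6 * m / 3 + k] p = (rotAB (6 * m))^[6 * m / 3] q ↔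
      (4 * m : ℤ) ∣ rankS m p + k - rankS m q := by
  rw [show 6 * m / 3 = 2 * m by omega]
  obtain ⟨hpm, hpd, hpl⟩ := rotAB_iterate hp (2 * m + k)
  obtain ⟨hqm, hqd, hql⟩ := rotAB_iterate hq (2 * m)
  have hp0 := rankS_nonneg hp
  have hq0 := rankS_nonneg hq
  push_cast at *
  constructor
  · intro h
    rw [h] at hpd
    refine Dvd.dvd.trans (hqd.sub hpd) (dvd_of_eq ?_)
    ring
  · intro h
    refine rankS_inj hpm hqm (sub_eq_zero.mp (Int.eq_zero_of_abs_lt_dvd (m := 4 * m) ?_ ?_))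
    · refine Dvd.dvd.trans ((hpd.sub hqd).add h) (dvd_of_eq ?_)
      ring
    · have h1 := rankS_lt hpm
      have h2 := rankS_lt hqm
      rw [abs_lt]
      omega

theorem dpos_le {m : ℕ} {p q : ℤ} (hp : p ∈ SetS (6 * m)) (hq : q ∈ SetS (6 * m)) {k : ℕ}
    (hk : 1 ≤ k) (h : (4 * m : ℤ) ∣ rankS m p + k - rankS m q) : dpos (6 * m) p q ≤ k :=
  Nat.sInf_le ⟨hk, (rotAB_iterate_eq_iff_s14 hp hq k).mpr h⟩

theorem dpos_spec {m : ℕ} (hm : 0 < m) {p q : ℤ} (hp : p ∈ SetS (6 * m))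
    (hq : q ∈ SetS (6 * m)) :
    1 ≤ dpos (6 * m) p q ∧ dpos (6 * m) p q ≤ 4 * m ∧
      (4 * m : ℤ) ∣ rankS m p + dpos (6 * m) p q - rankS m q := by
  have hpos : (0 : ℤ) < 4 * m := by omega
  have h0 := Int.emod_nonneg (rankS m q - rankS m p - 1) hpos.ne'
  have h1 := Int.emod_lt_of_pos (rankS m q - rankS m p - 1) hpos
  have h2 := Int.dvd_sub_self_of_emod_eq
    (rfl : (rankS m q - rankS m p - 1) % (4 * m : ℤ) = _)
  obtain ⟨k, hk⟩ := Int.eq_ofNat_of_zero_le h0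
  rw [hk] at h1 h2
  have hdvd : (4 * m : ℤ) ∣ rankS m p + (k + 1 : ℕ) - rankS m q := by
    refine h2.trans (dvd_of_eq ?_)
    push_cast
    ring
  have hmem : dpos (6 * m) p q ∈ {k : ℕ | 1 ≤ k ∧
      (rotAB (6 * m))^[6 * m / 3 + k] p = (rotAB (6 * m))^[6 * m / 3] q} :=
    Nat.sInf_mem ⟨k + 1, by omega, (rotAB_iterate_eq_iff_s14 hp hq _).mpr hdvd⟩
  have hle := dpos_le hp hq (by omega) hdvd
  exact ⟨hmem.1, by omega, (rotAB_iterate_eq_iff_s14 hp hq _).mp hmem.2⟩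

theorem dpos_congr {m : ℕ} (hm : 0 < m) {p q p' q' : ℤ} (hp : p ∈ SetS (6 * m))
    (hq : q ∈ SetS (6 * m)) (hp' : p' ∈ SetS (6 * m)) (hq' : q' ∈ SetS (6 * m))
    (h : (4 * m : ℤ) ∣ (rankS m q' - rankS m p') - (rankS m q - rankS m p)) :
    dpos (6 * m) p' q' = dpos (6 * m) p q := by
  obtain ⟨h1, -, h2⟩ := dpos_spec hm hp hq
  obtain ⟨h1', -, h2'⟩ := dpos_spec hm hp' hq'
  apply le_antisymm
  · apply dpos_le hp' hq' h1
    refine Dvd.dvd.trans (h2.sub h) (dvd_of_eq ?_)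
    ring
  · apply dpos_le hp hq h1'
    refine Dvd.dvd.trans (h2'.add h) (dvd_of_eq ?_)
    ring

theorem dB_of_mem {n : ℕ} {p : ℤ} (hp : p ∈ SetS n) (q : ℤ) : dB n p q = dpos n p q :=
  if_pos hp

theorem dB_of_neg_mem {n : ℕ} {p : ℤ} (_hn : 6 ∣ n) (hp : -p ∈ SetS n) (q : ℤ) :
    dB n p q = dpos n (-q) (-p) := by
  apply if_neg
  simp only [SetS, Set.mem_ofPred_eq] at hp ⊢
  omega

theorem dB_Bstep_false {m : ℕ} (hm : 0 < m) {p q : ℤ} (hp : p ∈ SetS (6 * m))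
    (hq : q ∈ SetS (6 * m)) :
    dB (6 * m) (Bstep (6 * m) p false) (Bstep (6 * m) q false) = dB (6 * m) p q := by
  obtain ⟨hp', hpr⟩ := neg_Bstep_false_mem_and_rankS hp
  obtain ⟨hq', hqr⟩ := neg_Bstep_false_mem_and_rankS hq
  rw [dB_of_neg_mem (dvd_mul_right 6 m) hp', dB_of_mem hp]
  apply dpos_congr hm hp hq hq' hp'
  rcases hpr with hpr | hpr <;> rcases hqr with hqr | hqr <;> rw [hpr, hqr]
  · exact ⟨0, by ring⟩
  · exact ⟨-1, by ring⟩
  · exact ⟨1, by ring⟩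
  · exact ⟨0, by ring⟩

theorem dB_Bstep_true {m : ℕ} (hm : 0 < m) {p q : ℤ} (hp : p ∈ SetS (6 * m))
    (hq : q ∈ SetS (6 * m)) (hpn : p ≠ ((6 * m : ℕ) : ℤ)) (hqn : q ≠ ((6 * m : ℕ) : ℤ)) :
    dB (6 * m) (Bstep (6 * m) p true) (Bstep (6 * m) q true) = dB (6 * m) p q := by
  rw [dB_of_neg_mem (dvd_mul_right 6 m) (neg_Bstep_true_mem hp), dB_of_mem hp]
  apply dpos_congr hm hp hq (neg_Bstep_true_mem hq) (neg_Bstep_true_mem hp)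
  rw [rankS_neg_Bstep_true hp hpn, rankS_neg_Bstep_true hq hqn]
  exact ⟨0, by ring⟩

theorem dB_Bstep_true_le {m : ℕ} (hm : 0 < m) {p q : ℤ} (hp : p ∈ SetS (6 * m))
    (hq : q ∈ SetS (6 * m)) :
    dB (6 * m) (Bstep (6 * m) p true) (Bstep (6 * m) q true) ≤ 4 * m := by
  rw [dB_of_neg_mem (dvd_mul_right 6 m) (neg_Bstep_true_mem hp)]
  exact (dpos_spec hm (neg_Bstep_true_mem hq) (neg_Bstep_true_mem hp)).2.1

/-- The state `n` moves one step too far under `b`, which costs at most one when it is the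
target of a distance. -/
theorem dB_Bstep_true_right_le {m : ℕ} (hm : 0 < m) {p : ℤ} (hp : p ∈ SetS (6 * m))
    (hn : ((6 * m : ℕ) : ℤ) ∈ SetS (6 * m)) (hpn : p ≠ ((6 * m : ℕ) : ℤ)) :
    dB (6 * m) (Bstep (6 * m) p true) (Bstep (6 * m) ((6 * m : ℕ) : ℤ) true) ≤
      dB (6 * m) p ((6 * m : ℕ) : ℤ) + 1 := by
  rw [dB_of_neg_mem (dvd_mul_right 6 m) (neg_Bstep_true_mem hp), dB_of_mem hp]
  obtain ⟨-, -, h⟩ := dpos_spec hm hp hn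
  apply dpos_le (neg_Bstep_true_mem hn) (neg_Bstep_true_mem hp) (by omega)
  rw [rankS_neg_Bstep_true hp hpn, rankS_neg_Bstep_true_self hm]
  refine Dvd.dvd.trans (h.add (dvd_refl (4 * m : ℤ))) (dvd_of_eq ?_)
  push_cast
  ring

/-- When `n` is the source, its distances to other states shrink by one, except that a
distance of one becomes a full turn. -/
theorem dB_Bstep_true_left_le {m : ℕ} (hm : 0 < m) {q : ℤ} (hq : q ∈ SetS (6 * m))
    (hn : ((6 * m : ℕ) : ℤ) ∈ SetS (6 * m)) (hqn : q ≠ ((6 * m : ℕ) : ℤ))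
    (h1 : dB (6 * m) ((6 * m : ℕ) : ℤ) q ≠ 1) :
    dB (6 * m) (Bstep (6 * m) ((6 * m : ℕ) : ℤ) true) (Bstep (6 * m) q true) ≤
      dB (6 * m) ((6 * m : ℕ) : ℤ) q := by
  rw [dB_of_neg_mem (dvd_mul_right 6 m) (neg_Bstep_true_mem hn)]
  rw [dB_of_mem hn] at h1 ⊢
  obtain ⟨h0, -, h⟩ := dpos_spec hm hn hq
  refine le_trans (dpos_le (k := dpos (6 * m) ((6 * m : ℕ) : ℤ) q - 1) (neg_Bstep_true_mem hq)
    (neg_Bstep_true_mem hn) (by omega) ?_) (Nat.sub_le _ _)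
  rw [rankS_neg_Bstep_true hq hqn, rankS_neg_Bstep_true_self hm, Nat.cast_sub h0]
  refine Dvd.dvd.trans (h.sub (dvd_refl (4 * m : ℤ))) (dvd_of_eq ?_)
  push_cast
  ring

/-- If `q` directly follows `n`, then `b` merges them up to `≃`, so distances from the image
of `n` are distances from the image of `q`. -/
theorem dB_Bstep_true_left_eq {m : ℕ} (hm : 0 < m) {q r : ℤ} (hq : q ∈ SetS (6 * m))
    (hr : r ∈ SetS (6 * m)) (hn : ((6 * m : ℕ) : ℤ) ∈ SetS (6 * m))
    (hqn : q ≠ ((6 * m : ℕ) : ℤ)) (h1 : dB (6 * m) ((6 * m : ℕ) : ℤ) q = 1) :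
    dB (6 * m) (Bstep (6 * m) ((6 * m : ℕ) : ℤ) true) (Bstep (6 * m) r true) =
      dB (6 * m) (Bstep (6 * m) q true) (Bstep (6 * m) r true) := by
  rw [dB_of_neg_mem (dvd_mul_right 6 m) (neg_Bstep_true_mem hn),
    dB_of_neg_mem (dvd_mul_right 6 m) (neg_Bstep_true_mem hq)]
  rw [dB_of_mem hn] at h1
  obtain ⟨-, -, h⟩ := dpos_spec hm hn hq
  apply dpos_congr hm (neg_Bstep_true_mem hr) (neg_Bstep_true_mem hq)
    (neg_Bstep_true_mem hr) (neg_Bstep_true_mem hn)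
  rw [rankS_neg_Bstep_true hq hqn, rankS_neg_Bstep_true_self hm]
  rw [h1] at h
  refine Dvd.dvd.trans ((dvd_refl (4 * m : ℤ)).sub h) (dvd_of_eq ?_)
  push_cast
  ring

theorem muB_le {n : ℕ} {A : Set ℤ} {c : ℕ} (h : ∀ p ∈ A, ∃ q ∈ A, dB n p q ≤ c) :
    muB n A ≤ c := by
  rcases A.eq_empty_or_nonempty with rfl | hA
  · simp [muB]
  · apply csSup_le (hA.image _)
    rintro _ ⟨p, hp, rfl⟩
    obtain ⟨q, hq, hle⟩ := h p hp
    exact (Nat.sInf_le (Set.mem_image_of_mem _ hq)).trans hle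

theorem exists_dB_le_muB {m : ℕ} (hm : 0 < m) {A : Set ℤ} (hA : A ⊆ SetS (6 * m)) {p : ℤ}
    (hp : p ∈ A) : ∃ q ∈ A, dB (6 * m) p q ≤ muB (6 * m) A := by
  have hbdd : BddAbove ((fun p => sInf ((fun q => dB (6 * m) p q) '' A)) '' A) := by
    refine ⟨4 * m, ?_⟩
    rintro _ ⟨r, hr, rfl⟩
    refine (Nat.sInf_le (Set.mem_image_of_mem _ hr)).trans ?_
    rw [dB_of_mem (hA hr)]
    exact (dpos_spec hm (hA hr) (hA hr)).2.1
  obtain ⟨q, hq, h⟩ := Nat.sInf_mem (Set.Nonempty.image (fun q => dB (6 * m) p q) ⟨p, hp⟩)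
  exact ⟨q, hq, h.le.trans (le_csSup hbdd (Set.mem_image_of_mem _ hp))⟩

theorem muB_image_of_dB_eq {n : ℕ} {A : Set ℤ} {f : ℤ → ℤ}
    (h : ∀ p ∈ A, ∀ q ∈ A, dB n (f p) (f q) = dB n p q) : muB n (f '' A) = muB n A := by
  unfold muB
  rw [Set.image_image]
  congr 1
  refine Set.image_congr fun p hp => ?_
  rw [Set.image_image]
  congr 1
  exact Set.image_congr fun q hq => h p hp q hq

theorem exists_dB_Bstep_true_le {m : ℕ} (hm : 0 < m) {A : Set ℤ} (hA : A ⊆ SetS (6 * m))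
    {p : ℤ} (hp : p ∈ A) :
    ∃ q ∈ A, dB (6 * m) (Bstep (6 * m) p true) (Bstep (6 * m) q true) ≤
      muB (6 * m) A + 1 := by
  obtain ⟨q, hq, hle⟩ := exists_dB_le_muB hm hA hp
  by_cases hpn : p = ((6 * m : ℕ) : ℤ)
  · subst hpn
    by_cases hqn : q = ((6 * m : ℕ) : ℤ)
    · subst hqn
      refine ⟨_, hq, (dB_Bstep_true_le hm (hA hq) (hA hq)).trans ?_⟩
      rw [dB_of_mem (hA hq)] at hle
      obtain ⟨h0, -, h⟩ := dpos_spec hm (hA hq) (hA hq)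
      rw [add_sub_cancel_left] at h
      have := Int.le_of_dvd (by omega) h
      omega
    by_cases h1 : dB (6 * m) ((6 * m : ℕ) : ℤ) q = 1
    · obtain ⟨r, hr, hler⟩ := exists_dB_le_muB hm hA hq
      refine ⟨r, hr, ?_⟩
      rw [dB_Bstep_true_left_eq hm (hA hq) (hA hr) (hA hp) hqn h1]
      by_cases hrn : r = ((6 * m : ℕ) : ℤ)
      · subst hrn
        exact (dB_Bstep_true_right_le hm (hA hq) (hA hp) hqn).trans (by omega)
      · rw [dB_Bstep_true hm (hA hq) (hA hr) hqn hrn]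
        omega
    · exact ⟨q, hq, (dB_Bstep_true_left_le hm (hA hq) (hA hp) hqn h1).trans (by omega)⟩
  · refine ⟨q, hq, ?_⟩
    by_cases hqn : q = ((6 * m : ℕ) : ℤ)
    · subst hqn
      exact (dB_Bstep_true_right_le hm (hA hp) (hA hq) hpn).trans (by omega)
    · rw [dB_Bstep_true hm (hA hp) (hA hq) hpn hqn]
      omega

/-- Let `n` be divisible by 6 and `A ⊆ S`, acting in `ℬ_n`. Then
`μ(Aa) = μ(A)` and `μ(Ab) ≤ μ(A) + 1`; moreover if `n ∉ A` then
`μ(Ab) = μ(A)`. -/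
theorem measure_step (n : ℕ) (hn : 6 ∣ n) (A : Set ℤ) (hA : A ⊆ SetS n) :
    muB n (BactSet n A [false]) = muB n A ∧
    muB n (BactSet n A [true]) ≤ muB n A + 1 ∧
    ((n : ℤ) ∉ A → muB n (BactSet n A [true]) = muB n A) := by
  obtain ⟨m, rfl⟩ := hn
  have hm : ∀ p ∈ A, 0 < m := fun p hp => by
    have := hA hp
    simp only [SetS, Set.mem_ofPred_eq] at this
    omega
  refine ⟨muB_image_of_dB_eq fun p hp q hq => dB_Bstep_false (hm p hp) (hA hp) (hA hq),
    muB_le ?_, fun hnA => muB_image_of_dB_eq fun p hp q hq =>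
      dB_Bstep_true (hm p hp) (hA hp) (hA hq) (ne_of_mem_of_not_mem hp hnA)
        (ne_of_mem_of_not_mem hq hnA)⟩
  rintro _ ⟨p, hp, rfl⟩
  obtain ⟨q, hq, hle⟩ := exists_dB_Bstep_true_le (hm p hp) hA hp
  exact ⟨_, ⟨q, hq, rfl⟩, hle⟩
end

section
/- For every n ≥ 3, every synchronizing word w for the DFA 𝒜_n satisfies |w|_s ≥ ⌈(2/3)·n·(n−2) − 1⌉. -/
/-- The state reached from `q` after reading the word `w`. -/
def actWord {Q σ : Type*} (δ : Q → σ → Q) (q : Q) (w : List σ) : Q :=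
  w.foldl δ q

/-- A word `w` is synchronizing for the DFA with transition function `δ`:
starting in any state, after processing `w` one always ends in the same state. -/
def IsSyncWord {Q σ : Type*} (δ : Q → σ → Q) (w : List σ) : Prop :=
  ∃ qs : Q, ∀ q : Q, actWord δ q w = qs

/-- The switch count of a synchronizing automaton: the minimal switch count of a
synchronizing word. -/
noncomputable def swOf {Q σ : Type*} [DecidableEq σ] (δ : Q → σ → Q) : ℕ :=
  sInf {k | ∃ w : List σ, IsSyncWord δ w ∧ swc w = k}

/-- The minimal length of a synchronizing word. -/
noncomputable def sslOf {Q σ : Type*} (δ : Q → σ → Q) : ℕ :=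
  sInf {k | ∃ w : List σ, IsSyncWord δ w ∧ w.length = k}

/-- The state to which both symbols map the state `n` in `𝒜_n`. -/
def Atarget (n : ℕ) : ℕ :=
  if n % 3 = 0 then n / 3 else if n % 3 = 1 then (n + 2) / 3 else (n + 4) / 3

/-- Transitions of `𝒜_n` on state numbers `1,…,n`, symbols `false` (= `a`) and
`true` (= `b`): `1a = 1`, `1b = 2`; `(2k)a = 2k+1`, `(2k)b = 2k-1`;
`(2k+1)a = 2k`, `(2k+1)b = 2k+2`; and `na = nb = Atarget n`. -/
def Af (n x : ℕ) (s : Bool) : ℕ :=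
  if x = n then Atarget n
  else if s then (if x % 2 = 0 then x - 1 else x + 1)
  else (if x = 1 then 1 else if x % 2 = 0 then x + 1 else x - 1)

/-- The binary automaton `𝒜_n`, with states `{1,…,n}` encoded as `Fin n`
(state `x` is `⟨x-1, _⟩`). -/
def Astep (n : ℕ) : Fin n → Bool → Fin n := fun q s =>
  ⟨Af n ((q : ℕ) + 1) s - 1, by
    have hq := q.isLt
    unfold Af Atarget; split_ifs <;> omega⟩

/-- The signed position `p` on the doubled path `{1-n,…,n}` encodes the state `p` if `p ≥ 1` and the
state `1 - p` otherwise. -/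
def stateOf (p : ℤ) : ℤ := if 1 ≤ p then p else 1 - p

/-- The direction in which the letter `s` moves the signed position `p`. -/
def dirOf (p : ℤ) (s : Bool) : ℤ := if (p % 2 = 1 ↔ s = true) then 1 else -1

/-- The movement of signed positions in direction `e`, where both end points jump. -/
def posStep (n t e p : ℤ) : ℤ := if p = n then 1 - t else if p = 1 - n then t else p + e

/-- The displacement, on the universal cover of the cycle of length `n + t`, of a token at the
signed position `p` moving in direction `e`. -/
def liftStep (n e p : ℤ) : ℤ := if p = n then 1 else if p = 1 - n then -1 else e

/-- The signed position reached from `p` after reading a word. -/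
def posRun (n t : ℤ) : ℤ → List Bool → ℤ
  | p, [] => p
  | p, s :: w => posRun n t (posStep n t (dirOf p s) p) w

/-- The total lifted displacement of a token starting at `p` and reading a word. -/
def liftRun (n t : ℤ) : ℤ → List Bool → ℤ
  | _, [] => 0
  | p, s :: w => liftStep n (dirOf p s) p + liftRun n t (posStep n t (dirOf p s) p) w

/-- The two possible relations between the positions and the lifted gap `D` of a pair of tokens
that has not been merged. -/
def GapInv (n t p q D : ℤ) : Prop :=
  (D = 0 ∧ q = p + (n + t)) ∨ (0 < D ∧ D < n + t ∧ (D = q - p ∨ D = q - p + (n + t)))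

/-- A lower bound for the number of switches before the token at `q`, moving in direction `e`,
reaches the position `n` with direction `-1`. -/
def approachCost (n t e q : ℤ) : ℤ :=
  if e = 1 then
    if q = n then min (n + t - 1) (2 * n - 2 * t - 1) else min (n - q - 1) (2 * n + q - t - 1)
  else min (n - q) (2 * n + q - t - 2)

/-- A lower bound for the number of switches before the lifted gap of the pair `p, q` grows. -/
def pairCost (n t e p q : ℤ) : ℤ :=
  min (approachCost n t e q) (approachCost n t (-e) (1 - p))

/-- The potential of a pair of tokens, where `S D` bounds the number of switches needed once the
gap `D` is about to grow. -/
def gapPotential (n t : ℤ) (S : ℤ → ℤ) (e p q D : ℤ) : ℤ :=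
  if D = 0 then S 2 + (n - t - 2) else S D + pairCost n t e p q

/-- The relation between `n` and the jump target `t`. -/
structure TargetRel (n t : ℤ) : Prop where
  three_le : 3 ≤ n
  one_le : 1 ≤ t
  lt : t < n
  le_three_mul : n ≤ 3 * t
  three_mul_le : 3 * t ≤ n + 4
  parity : (n - t) % 2 = 0

/-- The recursion satisfied by the bounds used in `gapPotential`. -/
structure GapWeights (n t : ℤ) (S : ℤ → ℤ) : Prop where
  last : S (n + t - 2) = 1
  step : ∀ D, 2 ≤ D → D % 2 = 0 → D ≤ n + t - 4 →
    S D = S (D + 2) + (n - t + min D (n + t - 2 - D))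

theorem le_pairCost_one {n t p q x : ℤ} : x ≤ pairCost n t 1 p q ↔
    (q = n → x ≤ n + t - 1 ∧ x ≤ 2 * n - 2 * t - 1) ∧
      (q ≠ n → x ≤ n - q - 1 ∧ x ≤ 2 * n + q - t - 1) ∧
      x ≤ n - (1 - p) ∧ x ≤ 2 * n + (1 - p) - t - 2 := by
  unfold pairCost approachCost
  simp only [if_true, show ¬ (-1 : ℤ) = 1 by norm_num, if_false]
  split_ifs <;> simp only [le_min_iff] <;> omega

theorem le_pairCost_neg_one {n t p q x : ℤ} : x ≤ pairCost n t (-1) p q ↔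
    (1 - p = n → x ≤ n + t - 1 ∧ x ≤ 2 * n - 2 * t - 1) ∧
      (1 - p ≠ n → x ≤ n - (1 - p) - 1 ∧ x ≤ 2 * n + (1 - p) - t - 1) ∧
      x ≤ n - q ∧ x ≤ 2 * n + q - t - 2 := by
  unfold pairCost approachCost
  simp only [neg_neg, if_true, show ¬ (-1 : ℤ) = 1 by norm_num, if_false]
  split_ifs <;> simp only [le_min_iff] <;> omega

theorem step_cases (n t e p : ℤ) :
    (p = n ∧ posStep n t e p = 1 - t ∧ liftStep n e p = 1) ∨
    (p ≠ n ∧ p = 1 - n ∧ posStep n t e p = t ∧ liftStep n e p = -1) ∨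
    (p ≠ n ∧ p ≠ 1 - n ∧ posStep n t e p = p + e ∧ liftStep n e p = e) := by
  unfold posStep liftStep
  split_ifs <;> simp_all

theorem gapInv_step {n t : ℤ} {S : ℤ → ℤ} (h : TargetRel n t) (hS : GapWeights n t S)
    {e p q D : ℤ} (he : e = 1 ∨ e = -1) (hp : 1 - n ≤ p ∧ p ≤ n) (hq : 1 - n ≤ q ∧ q ≤ n)
    (hpq : (q - p) % 2 = 0) (hD : GapInv n t p q D) (hpot : 1 < gapPotential n t S e p q D) :
    GapInv n t (posStep n t e p) (posStep n t e q) (D + liftStep n e q - liftStep n e p) ∨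
      (posStep n t e p = posStep n t e q ∧ D + liftStep n e q - liftStep n e p = 0) := by
  obtain ⟨h3, h1, hlt, hle, hge, hpar⟩ := h
  have hgoal : D = n + t - 2 → ¬ (e = -1 ∧ q = n) ∧ ¬ (e = 1 ∧ p = 1 - n) := by
    rintro rfl
    rw [gapPotential, if_neg (by omega), hS.last] at hpot
    have hpos : 1 ≤ pairCost n t e p q := by omega
    constructor
    · rintro ⟨rfl, rfl⟩
      have := le_pairCost_neg_one.1 hpos
      omega
    · rintro ⟨rfl, rfl⟩
      have := le_pairCost_one.1 hpos
      omega
  clear hpot hS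
  unfold GapInv at *
  rcases step_cases n t e p with ⟨hp0, hp1, hp2⟩ | ⟨hp', hp0, hp1, hp2⟩ | ⟨hp', hp0, hp1, hp2⟩ <;>
  rcases step_cases n t e q with ⟨hq0, hq1, hq2⟩ | ⟨hq', hq0, hq1, hq2⟩ | ⟨hq', hq0, hq1, hq2⟩ <;>
  rw [hp1, hp2, hq1, hq2] <;> clear hp1 hp2 hq1 hq2 <;>
  rcases hD with hD | ⟨hD0, hDC, hD | hD⟩ <;> rcases he with rfl | rfl <;> omega

set_option maxHeartbeats 4000000 in
theorem gapPotential_step {n t : ℤ} {S : ℤ → ℤ} (h : TargetRel n t) (hS : GapWeights n t S)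
    {e e' p q D : ℤ} (he : e = 1 ∨ e = -1) (he' : e' = 1 ∨ e' = -1)
    (hp : 1 - n ≤ p ∧ p ≤ n) (hq : 1 - n ≤ q ∧ q ≤ n)
    (hpq : (q - p) % 2 = 0) (hD : GapInv n t p q D)
    (hD' : GapInv n t (posStep n t e p) (posStep n t e q)
      (D + liftStep n e q - liftStep n e p)) :
    gapPotential n t S e p q D ≤ (if e = e' then 1 else 0) +
      gapPotential n t S e' (posStep n t e p) (posStep n t e q)
        (D + liftStep n e q - liftStep n e p) := by
  obtain ⟨h3, h1, hlt, hle, hge, hpar⟩ := h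
  generalize hE : D + liftStep n e q - liftStep n e p = D' at hD' ⊢
  have hDpar : D % 2 = 0 := by unfold GapInv at hD; omega
  have hsame : D' = D → S D' = S D := by rintro rfl; rfl
  have hzero_up : D = 0 → D' = D + 2 → S D' = S 2 := by rintro rfl rfl; rfl
  have hup : D' = D + 2 → D ≠ 0 → S D ≤ S D' + (n - t + D) ∧ S D ≤ S D' + (2 * n - 2 - D) := by
    rintro rfl hD0
    have := hS.step D
    unfold GapInv at hD hD'
    omega
  have hdown : D' = D - 2 → D' ≠ 0 → S D + (n - t) ≤ S D' := by
    rintro rfl hD0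
    have := hS.step (D - 2)
    rw [show D - 2 + 2 = D by ring] at this
    unfold GapInv at hD hD'
    omega
  clear hS
  obtain ⟨L, hL⟩ : ∃ L, pairCost n t e p q = L := ⟨_, rfl⟩
  unfold gapPotential
  rw [hL]
  replace hL := hL.ge
  generalize S 2 = S2 at *
  generalize S D = S0 at *
  generalize S D' = S' at *
  have hzero : D' = 0 → D = 0 := by
    clear hsame hzero_up hup hdown hL
    unfold GapInv at *
    rcases step_cases n t e p with ⟨hp0, hp1, hp2⟩ | ⟨hp', hp0, hp1, hp2⟩ | ⟨hp', hp0, hp1, hp2⟩ <;>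
    rcases step_cases n t e q with ⟨hq0, hq1, hq2⟩ | ⟨hq', hq0, hq1, hq2⟩ | ⟨hq', hq0, hq1, hq2⟩ <;>
    rw [hp1, hq1] at hD' <;> rw [hp2, hq2] at hE <;>
    clear hp1 hp2 hq1 hq2 <;> rcases he with rfl | rfl <;> omega
  suffices hR : D' ≠ 0 → (if D = 0 then S2 + (n - t - 2) else S0 + L) -
      (if e = e' then 1 else 0) - S' ≤
        pairCost n t e' (posStep n t e p) (posStep n t e q) by
    split_ifs at hR ⊢ <;> omega
  intro hD'0
  unfold GapInv at *
  rcases step_cases n t e p with ⟨hp0, hp1, hp2⟩ | ⟨hp', hp0, hp1, hp2⟩ | ⟨hp', hp0, hp1, hp2⟩ <;>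
  rcases step_cases n t e q with ⟨hq0, hq1, hq2⟩ | ⟨hq', hq0, hq1, hq2⟩ | ⟨hq', hq0, hq1, hq2⟩ <;>
  rw [hp1, hq1] at hD' ⊢ <;> rw [hp2, hq2] at hE <;>
  clear hp1 hp2 hq1 hq2 <;>
  rcases hD with hD | ⟨hD0, hDC, hD | hD⟩ <;> rcases he with rfl | rfl <;>
  first
  | (exfalso; clear hsame hzero_up hup hdown hL; omega)
  | (simp only [le_pairCost_one, le_pairCost_neg_one] at hL
     rcases he' with rfl | rfl <;>
     simp only [le_pairCost_one, le_pairCost_neg_one] <;>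
     split_ifs <;> omega)

theorem dirOf_eq (p : ℤ) (s : Bool) : dirOf p s = 1 ∨ dirOf p s = -1 := by
  unfold dirOf
  split_ifs <;> simp

theorem dirOf_congr {p q : ℤ} (h : (q - p) % 2 = 0) (s : Bool) : dirOf q s = dirOf p s := by
  have : q % 2 = p % 2 := by omega
  simp [dirOf, this]

theorem posStep_parity {n t p e : ℤ} (h : (n - t) % 2 = 0) (he : e = 1 ∨ e = -1) :
    (posStep n t e p - p) % 2 = 1 := by
  unfold posStep
  split_ifs <;> omega

theorem posStep_mem {n t p e : ℤ} (h : TargetRel n t) (he : e = 1 ∨ e = -1)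
    (hp : 1 - n ≤ p ∧ p ≤ n) : 1 - n ≤ posStep n t e p ∧ posStep n t e p ≤ n := by
  have := h.one_le
  have := h.lt
  unfold posStep
  split_ifs <;> omega

theorem dirOf_posStep {n t p e : ℤ} (h : (n - t) % 2 = 0) (he : e = 1 ∨ e = -1) (s s' : Bool) :
    dirOf p s = dirOf (posStep n t e p) s' ↔ s ≠ s' := by
  have hpar := posStep_parity (p := p) h he
  have : posStep n t e p % 2 = 1 ↔ ¬ p % 2 = 1 := by omega
  simp only [dirOf, this]
  by_cases hp : p % 2 = 1 <;> cases s <;> cases s' <;> simp [hp]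

theorem posRun_parity {n t : ℤ} (h : (n - t) % 2 = 0) (w : List Bool) :
    ∀ p q, (q - p) % 2 = 0 → (posRun n t q w - posRun n t p w) % 2 = 0 := by
  induction w with
  | nil => exact fun p q hpq => hpq
  | cons s w ih =>
    intro p q hpq
    apply ih
    have h1 := posStep_parity (p := p) h (dirOf_eq p s)
    have h2 := posStep_parity (p := q) h (dirOf_eq q s)
    omega

theorem one_le_swc_cons {σ : Type*} [DecidableEq σ] (w : List σ) : ∀ s : σ, 1 ≤ swc (s :: w) := by
  induction w with
  | nil => simp [swc]
  | cons s' w ih => exact fun s => (ih s').trans (by simp [swc])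

theorem gap_eq_zero_of_posRun_eq {n t : ℤ} {S : ℤ → ℤ} (h : TargetRel n t)
    (hS : GapWeights n t S) (w : List Bool) :
    ∀ p q D, 1 - n ≤ p ∧ p ≤ n → 1 - n ≤ q ∧ q ≤ n → (q - p) % 2 = 0 → GapInv n t p q D →
      (∀ s w', w = s :: w' → (swc w : ℤ) < gapPotential n t S (dirOf p s) p q D) →
      posRun n t p w = posRun n t q w → D + liftRun n t q w - liftRun n t p w = 0 := by
  induction w with
  | nil =>
    intro p q D _ _ _ hD _ hpq
    have h1 := h.one_le
    have h2 := h.lt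
    simp only [posRun] at hpq
    unfold GapInv at hD
    omega
  | cons s w ih =>
    intro p q D hp hq hpq hD hw hrun
    have he := dirOf_eq p s
    have hpot := hw s w rfl
    have hswc := one_le_swc_cons w s
    simp only [posRun, liftRun, dirOf_congr hpq] at hrun ⊢
    rcases gapInv_step h hS he hp hq hpq hD (by omega) with hD' | ⟨heq, h0⟩
    · have hpar1 := posStep_parity (p := p) h.parity he
      have hpar2 := posStep_parity (p := q) h.parity he
      have := ih _ _ _ (posStep_mem h he hp) (posStep_mem h he hq) (by omega) hD' ?_ hrun
      · linarith
      · rintro s' w' rfl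
        have hle := gapPotential_step h hS he (dirOf_eq (posStep n t (dirOf p s) p) s')
          hp hq hpq hD hD'
        simp only [dirOf_posStep h.parity he s s'] at hle
        simp only [swc] at hpot
        by_cases hs : s = s' <;> simp [hs] at hle hpot ⊢ <;> linarith
    · rw [heq]
      linarith

/-- The canonical weights, obtained by solving the recursion of `GapWeights`. -/
def gapWeight (n t D : ℤ) : ℤ :=
  1 + ∑ i ∈ Finset.range ((n + t - 2 - D) / 2).toNat,
    (n - t + min (n + t - 2 - 2 * ((i : ℤ) + 1)) (2 * ((i : ℤ) + 1)))

theorem gapWeights_gapWeight {n t : ℤ} (h : TargetRel n t) : GapWeights n t (gapWeight n t) where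
  last := by simp [gapWeight]
  step D h2 hD hle := by
    have hpar := h.parity
    obtain ⟨k, hk⟩ : ∃ k : ℕ, n + t - 2 - D = 2 * ((k : ℤ) + 1) :=
      ⟨((n + t - 4 - D) / 2).toNat, by omega⟩
    have h1 : ((n + t - 2 - D) / 2).toNat = k + 1 := by omega
    have h3 : ((n + t - 2 - (D + 2)) / 2).toNat = k := by omega
    unfold gapWeight
    rw [h1, h3, Finset.sum_range_succ, ← hk]
    rw [show n + t - 2 - (n + t - 2 - D) = D by ring]
    ring

theorem sq_le_sum_min (k : ℕ) : ((k : ℤ) + 1) ^ 2 ≤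
    2 * ∑ i ∈ Finset.range k, min (2 * ((k : ℤ) - i)) (2 * ((i : ℤ) + 1)) + 1 := by
  induction k using Nat.twoStepInduction with
  | zero => simp
  | one => simp
  | more k ih _ =>
    rw [Finset.sum_range_succ, Finset.sum_range_succ']
    have hmid : ∑ i ∈ Finset.range k, min (2 * (((k + 2 : ℕ) : ℤ) - ((i + 1 : ℕ) : ℤ)))
        (2 * (((i + 1 : ℕ) : ℤ) + 1)) =
        ∑ i ∈ Finset.range k, min (2 * ((k : ℤ) - i)) (2 * ((i : ℤ) + 1)) + 2 * k := by
      have hconst : (2 * k : ℤ) = ∑ _i ∈ Finset.range k, (2 : ℤ) := by simp [mul_comm]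
      rw [hconst, ← Finset.sum_add_distrib]
      refine Finset.sum_congr rfl fun i _ => ?_
      push_cast
      omega
    rw [hmid]
    push_cast
    rw [min_eq_right (by linarith), min_eq_left (by linarith)]
    linarith

theorem le_gapWeight_two {n t : ℤ} (h : TargetRel n t) :
    2 * n * (n - 2) ≤ 3 * (gapWeight n t 2 + (n - t - 2) + 1) := by
  obtain ⟨h3, h1, hlt, hle, hge, hpar⟩ := h
  obtain ⟨k, hk⟩ : ∃ k : ℕ, n + t - 4 = 2 * (k : ℤ) := ⟨((n + t - 4) / 2).toNat, by omega⟩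
  have hk' : ((n + t - 2 - 2) / 2).toNat = k := by omega
  have hsum : gapWeight n t 2 = 1 + (k * (n - t) +
      ∑ i ∈ Finset.range k, min (2 * ((k : ℤ) - i)) (2 * ((i : ℤ) + 1))) := by
    unfold gapWeight
    rw [hk', Finset.sum_add_distrib]
    congr 2
    · rw [Finset.sum_const, Finset.card_range, nsmul_eq_mul]
    · refine Finset.sum_congr rfl fun i _ => ?_
      rw [show n + t - 2 - 2 * ((i : ℤ) + 1) = 2 * ((k : ℤ) - i) by linarith]
  have hsq := sq_le_sum_min k
  rw [hsum]
  generalize ∑ i ∈ Finset.range k, min (2 * ((k : ℤ) - i)) (2 * ((i : ℤ) + 1)) = f at *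
  generalize (k : ℤ) = k at *
  obtain rfl : t = 2 * k + 4 - n := by linarith
  have hcases : 3 * k = 2 * n - 6 ∨ 3 * k = 2 * n - 5 ∨ 3 * k = 2 * n - 4 := by omega
  rcases hcases with hc | hc | hc
  · obtain ⟨m, rfl⟩ : ∃ m, n = 3 * m := ⟨n / 3, by omega⟩
    obtain rfl : k = 2 * m - 2 := by omega
    ring_nf at *
    omega
  · obtain ⟨m, rfl⟩ : ∃ m, n = 3 * m + 1 := ⟨n / 3, by omega⟩
    obtain rfl : k = 2 * m - 1 := by omega
    ring_nf at *
    omega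
  · obtain ⟨m, rfl⟩ : ∃ m, n = 3 * m + 2 := ⟨n / 3, by omega⟩
    obtain rfl : k = 2 * m := by omega
    ring_nf at *
    omega

theorem targetRel_Atarget {n : ℕ} (hn : 3 ≤ n) : TargetRel (n : ℤ) (Atarget n : ℤ) := by
  unfold Atarget
  constructor <;> (try split_ifs) <;> (try push_cast) <;> omega

theorem Af_stateOf {n : ℕ} (hn : 3 ≤ n) {p : ℤ} (hp : 1 - (n : ℤ) ≤ p ∧ p ≤ n) (s : Bool) {x : ℕ}
    (hx : (x : ℤ) = stateOf p) :
    (Af n x s : ℤ) = stateOf (posStep n (Atarget n) (dirOf p s) p) := by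
  have ht := (targetRel_Atarget hn).one_le
  unfold stateOf at hx
  unfold Af posStep dirOf stateOf
  generalize Atarget n = t at *
  cases s <;> simp only [if_true, Bool.false_eq_true, if_false, iff_true, iff_false] <;>
    split_ifs at * <;> omega

theorem actWord_stateOf {n : ℕ} (hn : 3 ≤ n) (w : List Bool) :
    ∀ (p : ℤ) (x : Fin n), 1 - (n : ℤ) ≤ p ∧ p ≤ n → (x.val : ℤ) + 1 = stateOf p →
      ((actWord (Astep n) x w).val : ℤ) + 1 = stateOf (posRun n (Atarget n) p w) := by
  induction w with
  | nil => exact fun p x _ hx => hx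
  | cons s w ih =>
    intro p x hp hx
    have hstep := Af_stateOf hn hp s (x := x + 1) (by exact_mod_cast hx)
    have hmem := posStep_mem (targetRel_Atarget hn) (dirOf_eq p s) hp
    refine ih _ _ hmem ?_
    rw [← hstep]
    have hpos : 1 ≤ stateOf (posStep n (Atarget n) (dirOf p s) p) := by
      unfold stateOf
      split_ifs <;> omega
    simp only [Astep]
    omega

theorem posRun_eq_of_isSyncWord {n : ℕ} (hn : 3 ≤ n) {w : List Bool}
    (hw : IsSyncWord (Astep n) w) {p q : ℤ} (hp : 1 - (n : ℤ) ≤ p ∧ p ≤ n)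
    (hq : 1 - (n : ℤ) ≤ q ∧ q ≤ n) (hpq : (q - p) % 2 = 0) :
    posRun n (Atarget n) p w = posRun n (Atarget n) q w := by
  obtain ⟨z, hz⟩ := hw
  have hrep : ∀ r : ℤ, 1 - (n : ℤ) ≤ r ∧ r ≤ n →
      stateOf (posRun n (Atarget n) r w) = (z.val : ℤ) + 1 := by
    intro r hr
    have hs : 1 ≤ stateOf r ∧ stateOf r ≤ n := by
      unfold stateOf
      split_ifs <;> omega
    rw [← actWord_stateOf hn w r ⟨(stateOf r - 1).toNat, by omega⟩ hr (by simp; omega), hz]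
  have h1 := (hrep p hp).trans (hrep q hq).symm
  have h2 := posRun_parity (targetRel_Atarget hn).parity w p q hpq
  unfold stateOf at h1
  split_ifs at h1 <;> omega

theorem no_telescoping {n t : ℤ} (h : TargetRel n t) {f : ℤ → ℤ}
    (hlow : ∀ p, 1 - t ≤ p → p ≤ t - 3 → f (p + 2) = f p - 2)
    (hhigh : ∀ p, t - 1 ≤ p → p ≤ n - 1 → (p - t) % 2 = 1 → f (p + 2 - (n + t)) = f p - 2)
    (hsame : ∀ p, 1 - n ≤ p → p + (n + t) ≤ n → f (p + (n + t)) = f p) : False := by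
  obtain ⟨h3, h1, hlt, hle, hge, hpar⟩ := h
  have hchain : ∀ k : ℕ, 2 * (k : ℤ) ≤ n + t - 2 → f (1 - t + 2 * k) = f (1 - t) - 2 * k := by
    intro k
    induction k with
    | zero => simp
    | succ k ih =>
      intro hk
      push_cast at hk ⊢
      have ihk := ih (by linarith)
      rcases le_or_gt (1 - t + 2 * (k : ℤ)) (t - 3) with hc | hc
      · have := hlow (1 - t + 2 * k) (by omega) hc
        rw [show 1 - t + 2 * ((k : ℤ) + 1) = 1 - t + 2 * k + 2 by ring]
        linarith
      · have h1 := hhigh (1 - t + 2 * k) (by omega) (by omega) (by omega)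
        have h2 := hsame (1 - t + 2 * k + 2 - (n + t)) (by omega) (by omega)
        rw [show 1 - t + 2 * (k : ℤ) + 2 - (n + t) + (n + t) = 1 - t + 2 * ((k : ℤ) + 1) by ring]
          at h2
        linarith
  obtain ⟨k, hk⟩ : ∃ k : ℕ, n + t - 2 = 2 * (k : ℤ) := ⟨((n + t - 2) / 2).toNat, by omega⟩
  have hlast := hchain k hk.ge
  have hwrap := hhigh (n - 1) (by omega) le_rfl (by omega)
  rw [show 1 - t + 2 * (k : ℤ) = n - 1 by linarith] at hlast
  rw [show n - 1 + 2 - (n + t) = 1 - t by ring] at hwrap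
  linarith

theorem le_gapPotential_two {n t : ℤ} {S : ℤ → ℤ} (h : TargetRel n t) {e p q : ℤ}
    (he : e = 1 ∨ e = -1) (hp : -t ≤ p) (hpn : p ≤ n) (hq : q ≤ t + 1) (hqn : 1 - n ≤ q) :
    S 2 + (n - t - 2) ≤ gapPotential n t S e p q 2 := by
  obtain ⟨h3, h1, hlt, hle, hge, hpar⟩ := h
  rw [gapPotential, if_neg (by norm_num)]
  suffices n - t - 2 ≤ pairCost n t e p q by linarith
  rcases he with rfl | rfl <;> simp only [le_pairCost_one, le_pairCost_neg_one] <;> omega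

theorem le_swc_of_isSyncWord {n : ℕ} (hn : 3 ≤ n) {w : List Bool}
    (hw : IsSyncWord (Astep n) w) :
    gapWeight n (Atarget n) 2 + (n - Atarget n - 2) ≤ (swc w : ℤ) := by
  have h := targetRel_Atarget hn
  have hS := gapWeights_gapWeight h
  by_contra! hlt
  have hgap : ∀ p q D : ℤ, 1 - (n : ℤ) ≤ p ∧ p ≤ n → 1 - (n : ℤ) ≤ q ∧ q ≤ n →
      (q - p) % 2 = 0 → GapInv n (Atarget n) p q D →
      (∀ e : ℤ, e = 1 ∨ e = -1 → gapWeight n (Atarget n) 2 + (n - Atarget n - 2) ≤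
        gapPotential n (Atarget n) (gapWeight n (Atarget n)) e p q D) →
      D + liftRun n (Atarget n) q w - liftRun n (Atarget n) p w = 0 :=
    fun p q D hp hq hpq hD hpot => gap_eq_zero_of_posRun_eq h hS w p q D hp hq hpq hD
      (fun s _ _ => hlt.trans_le (hpot _ (dirOf_eq p s))) (posRun_eq_of_isSyncWord hn hw hp hq hpq)
  have h1 := h.one_le
  have h2 := h.lt
  have hpar := h.parity
  refine no_telescoping h (f := fun p => liftRun n (Atarget n) p w) ?_ ?_ ?_
  · intro p hp hp'
    have := hgap p (p + 2) 2 (by omega) (by omega) (by omega) (Or.inr (by omega))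
      fun e he => le_gapPotential_two h he (by omega) (by omega) (by omega) (by omega)
    linarith
  · intro p hp hp' hmod
    have := hgap p (p + 2 - (n + Atarget n)) 2 (by omega) (by omega) (by omega) (Or.inr (by omega))
      fun e he => le_gapPotential_two h he (by omega) (by omega) (by omega) (by omega)
    linarith
  · intro p hp hp'
    have := hgap p (p + (n + Atarget n)) 0 (by omega) (by omega) (by omega) (Or.inl ⟨rfl, rfl⟩)
      fun e _ => by rw [gapPotential, if_pos rfl]
    linarith

/-- For every `n ≥ 3`, every synchronizing word `w` for the DFA `𝒜_n` satisfies
`|w|_s ≥ ⌈(2/3)·n·(n-2) - 1⌉`. -/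
theorem A_sw_lower (n : ℕ) (hn : 3 ≤ n) (w : List Bool)
    (hw : IsSyncWord (Astep n) w) :
    ⌈(2 / 3 : ℚ) * (n : ℚ) * ((n : ℚ) - 2) - 1⌉ ≤ (swc w : ℤ) := by
  have h := le_gapWeight_two (targetRel_Atarget hn)
  have hle := le_swc_of_isSyncWord hn hw
  have hz : 2 * (n : ℤ) * (n - 2) ≤ 3 * ((swc w : ℤ) + 1) := by linarith
  have hq : 2 * (n : ℚ) * (n - 2) ≤ 3 * ((swc w : ℚ) + 1) := by exact_mod_cast hz
  rw [Int.ceil_le]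
  push_cast
  linarith
end

section
/- Let n be divisible by 6. Then the word w = b(ab)^{n/3−1} · ∏_{k=2}^{n/3−1} ( b(ba)^k(ab)^{n/3} ) · b(ba)^{2n/3−1}b · ∏_{k=n/3+1}^{2n/3−1} ( (ba)^{n−k}b ) · b is a synchronizing word for the DFA 𝒜_n, and its switch count equals (2/3)·n·(n−2) − 1. -/
/-- The word `(ab)^m` (with `a` = `false`, `b` = `true`). -/
def abpow (m : ℕ) : List Bool := (List.replicate m [false, true]).flatten

/-- The word `(ba)^m` (with `a` = `false`, `b` = `true`). -/
def bapow (m : ℕ) : List Bool := (List.replicate m [true, false]).flatten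

/-- The word
`b(ab)^{n/3-1} · ∏_{k=2}^{n/3-1} (b(ba)^k(ab)^{n/3}) · b(ba)^{2n/3-1}b ·
∏_{k=n/3+1}^{2n/3-1} ((ba)^{n-k}b) · b`. -/
def bigWord (n : ℕ) : List Bool :=
  (true :: abpow (n / 3 - 1)) ++
    (((List.range' 2 (n / 3 - 2)).map fun k => true :: (bapow k ++ abpow (n / 3)))).flatten ++
    ((true :: bapow (2 * n / 3 - 1)) ++ [true]) ++
    (((List.range' (n / 3 + 1) (n / 3 - 1)).map fun k => bapow (n - k) ++ [true])).flatten ++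
    [true]

theorem actWord_append {Q σ : Type*} (δ : Q → σ → Q) (q : Q) (u v : List σ) :
    actWord δ q (u ++ v) = actWord δ (actWord δ q u) v :=
  List.foldl_append

theorem bapow_succ (t : ℕ) : bapow (t + 1) = true :: false :: bapow t := rfl

theorem abpow_succ (t : ℕ) : abpow (t + 1) = false :: true :: abpow t := rfl

/-! ### Switch counts of the factors -/

theorem swc_true_abpow_append (t : ℕ) (w : List Bool) :
    swc (true :: (abpow t ++ w)) = 2 * t + swc (true :: w) := by
  induction t with
  | zero => simp [abpow]
  | succ t ih =>
    simp only [abpow_succ, List.cons_append, swc, ih]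
    simp
    ring

theorem swc_false_bapow_append (t : ℕ) (w : List Bool) :
    swc (false :: (bapow t ++ w)) = 2 * t + swc (false :: w) := by
  induction t with
  | zero => simp [bapow]
  | succ t ih =>
    simp only [bapow_succ, List.cons_append, swc, ih]
    simp
    ring

theorem swc_true_bapow_append {t : ℕ} (ht : 0 < t) (w : List Bool) :
    swc (true :: (bapow t ++ w)) + 1 = 2 * t + swc (false :: w) := by
  obtain ⟨t, rfl⟩ := Nat.exists_eq_add_of_lt ht
  simp only [zero_add, bapow_succ, List.cons_append, swc, swc_false_bapow_append]
  simp
  ring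

theorem swc_false_abpow_append {t : ℕ} (ht : 0 < t) (w : List Bool) :
    swc (false :: (abpow t ++ w)) + 1 = 2 * t + swc (true :: w) := by
  obtain ⟨t, rfl⟩ := Nat.exists_eq_add_of_lt ht
  simp only [zero_add, abpow_succ, List.cons_append, swc, swc_true_abpow_append]
  simp
  ring

theorem swc_true_true (w : List Bool) : swc (true :: true :: w) = swc (true :: w) := by
  simp [swc]

theorem swc_false_true (w : List Bool) : swc (false :: true :: w) = 1 + swc (true :: w) := by
  simp [swc]

theorem swc_first_product {N : ℕ} (hN : 0 < N) (l s : ℕ) (hs : 0 < s) (w : List Bool) :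
    swc (true :: (((List.range' s l).map fun k => true :: (bapow k ++ abpow N)).flatten ++ w))
      + 3 * l = l * (2 * s + l + 2 * N) + swc (true :: w) := by
  induction l generalizing s with
  | zero => simp
  | succ l ih =>
    have h := ih (s + 1) (by omega)
    simp only [List.range'_succ, List.map_cons, List.flatten_cons, List.cons_append,
      List.append_assoc, swc_true_true]
    have h₁ := swc_true_bapow_append hs (abpow N ++
      (((List.range' (s + 1) l).map fun k => true :: (bapow k ++ abpow N)).flatten ++ w))
    have h₂ := swc_false_abpow_append hN
      (((List.range' (s + 1) l).map fun k => true :: (bapow k ++ abpow N)).flatten ++ w)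
    nlinarith

theorem swc_second_product {n : ℕ} (l s : ℕ) (hs : s + l ≤ n) (w : List Bool) :
    swc (true :: (((List.range' s l).map fun k => bapow (n - k) ++ [true]).flatten ++ w))
      + l * (2 * s + l) = l * (2 * n + 1) + swc (true :: w) := by
  induction l generalizing s with
  | zero => simp
  | succ l ih =>
    have h := ih (s + 1) (by omega)
    simp only [List.range'_succ, List.map_cons, List.flatten_cons, List.cons_append,
      List.append_assoc, List.nil_append]
    have h₁ := swc_true_bapow_append (t := n - s) (by omega) (true ::
      (((List.range' (s + 1) l).map fun k => bapow (n - k) ++ [true]).flatten ++ w))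
    rw [swc_false_true] at h₁
    obtain ⟨d, rfl⟩ : ∃ d, n = s + d := ⟨n - s, by omega⟩
    rw [Nat.add_sub_cancel_left] at h₁ ⊢
    nlinarith

theorem bigWord_six_mul (m : ℕ) : bigWord (6 * m) =
    true :: (abpow (2 * m - 1) ++
      (((List.range' 2 (2 * m - 2)).map fun k => true :: (bapow k ++ abpow (2 * m))).flatten ++
      (true :: (bapow (4 * m - 1) ++ (true ::
      (((List.range' (2 * m + 1) (2 * m - 1)).map fun k => bapow (6 * m - k) ++ [true]).flatten ++
        [true])))))) := by
  have h₁ : 6 * m / 3 = 2 * m := by omega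
  have h₂ : 2 * (6 * m) / 3 = 4 * m := by omega
  simp [bigWord, h₁, h₂]

theorem swc_bigWord_six_mul {m : ℕ} (hm : 0 < m) :
    swc (bigWord (6 * m)) + 8 * m + 1 = 24 * m ^ 2 := by
  rw [bigWord_six_mul, swc_true_abpow_append]
  set v := ((List.range' (2 * m + 1) (2 * m - 1)).map
    fun k => bapow (6 * m - k) ++ [true]).flatten ++ [true] with hv
  have h₁ := swc_first_product (N := 2 * m) (by omega) (2 * m - 2) 2 (by omega)
    (true :: (bapow (4 * m - 1) ++ (true :: v)))
  have h₂ := swc_true_bapow_append (t := 4 * m - 1) (by omega) (true :: v)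
  have h₃ := swc_second_product (n := 6 * m) (2 * m - 1) (2 * m + 1) (by omega) [true]
  rw [← hv, swc_true_true] at h₃
  rw [swc_true_true] at h₁
  rw [swc_false_true] at h₂
  obtain ⟨d, rfl⟩ := Nat.exists_eq_add_of_lt hm
  have e₁ : 2 * (0 + d + 1) - 2 = 2 * d := by omega
  have e₂ : 2 * (0 + d + 1) - 1 = 2 * d + 1 := by omega
  have e₃ : 4 * (0 + d + 1) - 1 = 4 * d + 3 := by omega
  simp only [e₁, e₂, e₃] at *
  have h₄ : swc [true] = 1 := rfl
  nlinarith

/-! ### Action of the factors on states -/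

theorem actWord_flatten_range' {Q σ : Type*} {δ : Q → σ → Q} {f : ℕ → List σ} {I : ℕ → Q → Prop}
    (l s : ℕ) (h : ∀ k, s ≤ k → k < s + l → ∀ q, I k q → I (k + 1) (actWord δ q (f k)))
    {q : Q} (hq : I s q) : I (s + l) (actWord δ q ((List.range' s l).map f).flatten) := by
  induction l generalizing s q with
  | zero => exact hq
  | succ l ih =>
    simp only [List.range'_succ, List.map_cons, List.flatten_cons, actWord_append]
    have := ih (s + 1) (fun k h₁ h₂ => h k (by omega) (by omega)) (h s le_rfl (by omega) q hq)
    rwa [show s + (l + 1) = s + 1 + l by ring]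

theorem Astep_val_add_one {n : ℕ} (q : Fin n) (s : Bool) :
    (Astep n q s : ℕ) + 1 = Af n (q + 1) s := by
  have hq := q.isLt
  simp only [Astep, Af, Atarget]
  split_ifs <;> omega

theorem actWord_Astep_val_add_one {n : ℕ} (q : Fin n) (w : List Bool) :
    ((actWord (Astep n) q w : Fin n) : ℕ) + 1 = actWord (Af n) (q + 1) w := by
  induction w generalizing q with
  | nil => rfl
  | cons s w ih =>
    simp only [actWord, List.foldl_cons] at ih ⊢
    rw [ih, Astep_val_add_one]

theorem Atarget_six_mul (m : ℕ) : Atarget (6 * m) = 2 * m := by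
  unfold Atarget
  split_ifs <;> omega

theorem Af_six_mul_true (m x : ℕ) : Af (6 * m) x true =
    if x = 6 * m then 2 * m else if x % 2 = 0 then x - 1 else x + 1 := by
  simp [Af, Atarget_six_mul]

theorem Af_six_mul_false (m x : ℕ) : Af (6 * m) x false =
    if x = 6 * m then 2 * m else if x = 1 then 1 else if x % 2 = 0 then x + 1 else x - 1 := by
  simp [Af, Atarget_six_mul]

/-- The orbit of the state `6 * m - 2` of `𝒜_{6m}` under the word `ba`, starting at index `1`
and given explicitly up to index `10 * m - 1`. -/
def baOrbit (m p : ℕ) : ℕ :=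
  if p < 3 * m then 6 * m - 2 * p else if p < 6 * m then 2 * p + 1 - 6 * m
  else if p < 7 * m then 14 * m - 2 * p else 2 * p + 1 - 14 * m

/-- The orbit of the state `6 * m - 1` of `𝒜_{6m}` under the word `ab`, starting at index `0`
and given explicitly up to index `10 * m - 1`. -/
def abOrbit (m p : ℕ) : ℕ :=
  if p < 3 * m then 6 * m - 1 - 2 * p else if p < 6 * m then 2 * p + 2 - 6 * m
  else if p < 7 * m then 14 * m - 1 - 2 * p else 2 * p + 2 - 14 * m

theorem actWord_bapow_baOrbit {m p t : ℕ} (hp : 0 < p) (h : p + t < 10 * m) :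
    actWord (Af (6 * m)) (baOrbit m p) (bapow t) = baOrbit m (p + t) := by
  induction t generalizing p with
  | zero => rfl
  | succ t ih =>
    have hstep : Af (6 * m) (Af (6 * m) (baOrbit m p) true) false = baOrbit m (p + 1) := by
      generalize hx : baOrbit m p = x
      generalize hy : Af (6 * m) x true = y
      rw [Af_six_mul_true] at hy
      rw [Af_six_mul_false]
      unfold baOrbit at hx ⊢
      split_ifs at hx hy ⊢ <;> omega
    rw [show p + (t + 1) = p + 1 + t by ring, ← ih (by omega) (by omega), ← hstep]
    rfl

theorem actWord_abpow_abOrbit {m p t : ℕ} (h : p + t < 10 * m) :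
    actWord (Af (6 * m)) (abOrbit m p) (abpow t) = abOrbit m (p + t) := by
  induction t generalizing p with
  | zero => rfl
  | succ t ih =>
    have hstep : Af (6 * m) (Af (6 * m) (abOrbit m p) false) true = abOrbit m (p + 1) := by
      generalize hx : abOrbit m p = x
      generalize hy : Af (6 * m) x false = y
      rw [Af_six_mul_false] at hy
      rw [Af_six_mul_true]
      unfold abOrbit at hx ⊢
      split_ifs at hx hy ⊢ <;> omega
    rw [show p + (t + 1) = p + 1 + t by ring, ← ih (by omega), ← hstep]
    rfl

theorem exists_baOrbit_eq {m x : ℕ} (h₁ : 0 < x) (h₂ : x < 6 * m) :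
    ∃ p, 0 < p ∧ p < 6 * m ∧ (x % 2 = 0 ∧ 2 * p + x = 6 * m ∨ x % 2 = 1 ∧ 2 * p + 1 = 6 * m + x) ∧
      baOrbit m p = x := by
  unfold baOrbit
  rcases Nat.mod_two_eq_zero_or_one x with h | h
  · exact ⟨3 * m - x / 2, by omega, by omega, by omega, by split_ifs <;> omega⟩
  · exact ⟨3 * m + x / 2, by omega, by omega, by omega, by split_ifs <;> omega⟩

theorem exists_abOrbit_eq {m x : ℕ} (h₁ : 0 < x) (h₂ : x ≤ 6 * m) :
    ∃ p, p < 6 * m ∧ (x % 2 = 1 ∧ 2 * p + 1 + x = 6 * m ∨ x % 2 = 0 ∧ 2 * p + 2 = 6 * m + x) ∧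
      abOrbit m p = x := by
  unfold abOrbit
  rcases Nat.mod_two_eq_zero_or_one x with h | h
  · exact ⟨3 * m + x / 2 - 1, by omega, by omega, by split_ifs <;> omega⟩
  · exact ⟨3 * m - 1 - x / 2, by omega, by omega, by split_ifs <;> omega⟩

theorem actWord_bapow_top {m t : ℕ} (hm : 0 < m) (h₁ : 0 < t) (h₂ : t ≤ 4 * m) :
    actWord (Af (6 * m)) (6 * m) (bapow t) = baOrbit m (4 * m - 1 + t) := by
  obtain ⟨t, rfl⟩ := Nat.exists_eq_add_of_lt h₁
  have hstep : Af (6 * m) (Af (6 * m) (6 * m) true) false = baOrbit m (4 * m) := by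
    simp only [Af_six_mul_true, Af_six_mul_false, baOrbit, if_true]
    split_ifs <;> omega
  rw [show 4 * m - 1 + (0 + t + 1) = 4 * m + t by omega,
    ← actWord_bapow_baOrbit (by omega) (by omega), ← hstep, zero_add]
  rfl

/-- The states of `𝒜_{6m}` that can be occupied after reading the prefix of the word that ends
with the factor of index `k - 1` of the first product. -/
def FirstOccupied (m k x : ℕ) : Prop :=
  0 < x ∧ (x ≤ 2 * m ∨ x % 2 = 0 ∧ x + 2 * k ≤ 6 * m + 2 ∨ x = 6 * m)

/-- The states of `𝒜_{6m}` that can be occupied after reading the prefix of the word that ends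
with the factor of index `k - 1` of the second product. -/
def SecondOccupied (m k x : ℕ) : Prop :=
  0 < x ∧ x ≤ 2 * m ∧ (x % 2 = 0 ∧ x + 2 * k ≤ 6 * m + 2 ∨ x % 2 = 1 ∧ 2 * k ≤ 6 * m + 1 + x) ∨
    x = 6 * m

theorem firstOccupied_initial {m x : ℕ} (h₁ : 0 < x) (h₂ : x ≤ 6 * m) :
    FirstOccupied m 2 (actWord (Af (6 * m)) x (true :: abpow (2 * m - 1))) := by
  change FirstOccupied m 2 (actWord (Af (6 * m)) (Af (6 * m) x true) (abpow (2 * m - 1)))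
  have hy : 0 < Af (6 * m) x true ∧ Af (6 * m) x true ≤ 6 * m ∧ Af (6 * m) x true ≠ 6 * m - 1 := by
    rw [Af_six_mul_true]
    split_ifs <;> omega
  obtain ⟨p, hp, hpy, h⟩ := exists_abOrbit_eq hy.1 hy.2.1
  rw [← h, actWord_abpow_abOrbit (by omega)]
  unfold FirstOccupied abOrbit
  split_ifs <;> omega

theorem firstOccupied_succ {m k x : ℕ} (h₁ : 2 ≤ k) (h₂ : k < 2 * m) (hx : FirstOccupied m k x) :
    FirstOccupied m (k + 1)
      (actWord (Af (6 * m)) x (true :: (bapow k ++ abpow (2 * m)))) := by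
  change FirstOccupied m (k + 1)
    (actWord (Af (6 * m)) (Af (6 * m) x true) (bapow k ++ abpow (2 * m)))
  rw [actWord_append]
  have hy : 0 < Af (6 * m) x true ∧ (Af (6 * m) x true ≤ 2 * m ∨
      Af (6 * m) x true % 2 = 1 ∧ Af (6 * m) x true + 2 * k ≤ 6 * m + 1) := by
    rw [Af_six_mul_true]
    unfold FirstOccupied at hx
    split_ifs <;> omega
  obtain ⟨p, hp₀, hp, hpy, h⟩ := exists_baOrbit_eq (m := m) hy.1 (by omega)
  rw [← h, actWord_bapow_baOrbit hp₀ (by omega)]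
  have hz : 0 < baOrbit m (p + k) ∧ baOrbit m (p + k) ≤ 6 * m ∧
      (baOrbit m (p + k) % 2 = 0 ∧ (baOrbit m (p + k) + 2 * k ≤ 2 * m ∨ baOrbit m (p + k) = 2 * m) ∨
      baOrbit m (p + k) % 2 = 1 ∧ 2 * k + 1 ≤ baOrbit m (p + k) + 2 * m) := by
    unfold baOrbit
    split_ifs <;> omega
  obtain ⟨r, hr, hrz, h'⟩ := exists_abOrbit_eq hz.1 hz.2.1
  rw [← h', actWord_abpow_abOrbit (by omega)]
  unfold FirstOccupied
  generalize baOrbit m (p + k) = z at hz hrz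
  unfold abOrbit
  split_ifs <;> omega

theorem secondOccupied_initial {m x : ℕ} (hm : 0 < m) (hx : FirstOccupied m (2 * m) x) :
    SecondOccupied m (2 * m + 1)
      (actWord (Af (6 * m)) x (true :: (bapow (4 * m - 1) ++ [true]))) := by
  change SecondOccupied m (2 * m + 1)
    (actWord (Af (6 * m)) (Af (6 * m) x true) (bapow (4 * m - 1) ++ [true]))
  have hy : 0 < Af (6 * m) x true ∧ Af (6 * m) x true ≤ 2 * m + 1 := by
    rw [Af_six_mul_true]
    unfold FirstOccupied at hx
    split_ifs <;> omega
  obtain ⟨p, hp₀, hp, hpy, h⟩ := exists_baOrbit_eq (m := m) hy.1 (by omega)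
  rw [actWord_append, ← h, actWord_bapow_baOrbit hp₀ (by omega)]
  change SecondOccupied m (2 * m + 1) (Af (6 * m) (baOrbit m (p + (4 * m - 1))) true)
  rw [Af_six_mul_true]
  generalize hz : baOrbit m (p + (4 * m - 1)) = z
  unfold baOrbit at hz
  unfold SecondOccupied
  split_ifs at hz ⊢ <;> omega

theorem secondOccupied_succ {m k x : ℕ} (h₁ : 2 * m < k) (h₂ : k < 4 * m)
    (hx : SecondOccupied m k x) :
    SecondOccupied m (k + 1) (actWord (Af (6 * m)) x (bapow (6 * m - k) ++ [true])) := by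
  obtain ⟨p, hp, h⟩ : ∃ p, ((x % 2 = 0 ∧ x ≤ 2 * m ∧ x + 2 * k ≤ 6 * m + 2 ∧ 2 * p + x = 6 * m ∨
      x % 2 = 1 ∧ x ≤ 2 * m ∧ 2 * k ≤ 6 * m + 1 + x ∧ 2 * p + 1 = 6 * m + x) ∧ 0 < x ∨
        p + 1 = 4 * m) ∧
      actWord (Af (6 * m)) x (bapow (6 * m - k)) = baOrbit m (p + (6 * m - k)) := by
    rcases hx with ⟨hx₀, hx₁, hx₂⟩ | rfl
    · obtain ⟨p, hp₀, hp, hpx, h⟩ := exists_baOrbit_eq (m := m) hx₀ (by omega)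
      refine ⟨p, by omega, ?_⟩
      rw [← actWord_bapow_baOrbit hp₀ (by omega), h]
    · exact ⟨4 * m - 1, by omega, actWord_bapow_top (by omega) (by omega) (by omega)⟩
  rw [actWord_append, h]
  change SecondOccupied m (k + 1) (Af (6 * m) (baOrbit m (p + (6 * m - k))) true)
  rw [Af_six_mul_true]
  generalize hz : baOrbit m (p + (6 * m - k)) = z
  unfold baOrbit at hz
  unfold SecondOccupied
  split_ifs at hz ⊢ <;> omega

theorem actWord_bigWord_six_mul {m x : ℕ} (hm : 0 < m) (h₁ : 0 < x) (h₂ : x ≤ 6 * m) :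
    actWord (Af (6 * m)) x (bigWord (6 * m)) = 2 * m := by
  have e₁ : 6 * m / 3 = 2 * m := by omega
  have e₂ : 2 * (6 * m) / 3 = 4 * m := by omega
  rw [bigWord, e₁, e₂, actWord_append, actWord_append, actWord_append,
    actWord_append _ _ _ (List.flatten _)]
  have hA := actWord_flatten_range' (δ := Af (6 * m)) (I := FirstOccupied m) (2 * m - 2) 2
    (fun k hk₁ hk₂ q hq => firstOccupied_succ hk₁ (by omega) hq) (firstOccupied_initial h₁ h₂)
  rw [show 2 + (2 * m - 2) = 2 * m by omega] at hA
  have hB := actWord_flatten_range' (δ := Af (6 * m)) (I := SecondOccupied m) (2 * m - 1)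
    (2 * m + 1) (fun k hk₁ hk₂ q hq => secondOccupied_succ (by omega) (by omega) hq)
    (secondOccupied_initial hm hA)
  rw [show 2 * m + 1 + (2 * m - 1) = 4 * m by omega] at hB
  have hlast : ∀ y, SecondOccupied m (4 * m) y → Af (6 * m) y true = 2 * m := by
    intro y hy
    rw [Af_six_mul_true]
    unfold SecondOccupied at hy
    split_ifs <;> omega
  exact hlast _ hB

/-- For `n` divisible by 6, the word `bigWord n` is a synchronizing word for
the DFA `𝒜_n`, and its switch count equals `(2/3)·n·(n-2) - 1`. -/
theorem bigWord_sync_swc (n : ℕ) (hpos : 0 < n) (hn : 6 ∣ n) :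
    IsSyncWord (Astep n) (bigWord n) ∧ swc (bigWord n) = 2 * n * (n - 2) / 3 - 1 := by
  obtain ⟨m, rfl⟩ := hn
  have hm : 0 < m := by omega
  refine ⟨⟨⟨2 * m - 1, by omega⟩, fun q => Fin.ext ?_⟩, ?_⟩
  · have h := actWord_Astep_val_add_one q (bigWord (6 * m))
    rw [actWord_bigWord_six_mul hm (by omega) (by omega)] at h
    exact Nat.eq_sub_of_add_eq h
  · have h := swc_bigWord_six_mul hm
    obtain ⟨d, rfl⟩ := Nat.exists_eq_add_of_lt hm
    rw [show 2 * (6 * (0 + d + 1)) * (6 * (0 + d + 1) - 2) = 3 * (4 * (d + 1) * (6 * d + 4)) by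
      rw [show 6 * (0 + d + 1) - 2 = 6 * d + 4 by omega]; ring,
      Nat.mul_div_cancel_left _ (by norm_num)]
    apply Nat.eq_sub_of_add_eq
    nlinarith
end

section
/- Let n be a prime number and let f, g : ℤ/nℤ → ℤ and A ∈ ℤ satisfy ∑_{i=0}^{n−1} f(i)·g(i+k) = A for every k = 0, 1, ..., n−1 (arguments of g taken modulo n). Then at least one of the functions f and g is constant. -/
/-- An integer combination of the values of an injective additive character modulo a prime
vanishes only if all coefficients agree. -/
theorem forall_eq_of_sum_mul_addChar_eq_zero {K : Type*} [Field K] [CharZero K] {n : ℕ} [NeZero n]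
    (hn : n.Prime) {ψ : AddChar (ZMod n) K} (hψ : Function.Injective ψ) {a : ZMod n → ℤ}
    (h : ∑ i, (a i : K) * ψ i = 0) (i j : ZMod n) : a i = a j := by
  have hpow (k : ℕ) : ψ 1 ^ k = ψ k := by
    rw [← AddChar.map_nsmul_eq_pow, nsmul_one]
  have hprim : IsPrimitiveRoot (ψ 1) n :=
    ⟨by rw [hpow, ZMod.natCast_self, AddChar.map_zero_eq_one], fun k hk ↦ by
      rw [hpow, ← ψ.map_zero_eq_one] at hk
      exact (ZMod.natCast_eq_zero_iff _ _).1 (hψ hk)⟩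
  have hsum : ∑ x : Fin n, (a (x.val : ZMod n) : K) * ψ 1 ^ x.val = 0 := by
    rw [← h]
    refine Fintype.sum_equiv (ZMod.finEquiv n).toEquiv _ _ fun x ↦ ?_
    have hx : (ZMod.finEquiv n).toEquiv x = (x.val : ZMod n) := by
      obtain ⟨m, rfl⟩ := Nat.exists_eq_succ_of_ne_zero (NeZero.ne n)
      exact (Fin.cast_val_eq_self x).symm
    rw [hx, hpow]
  have key := (hprim.sum_eq_zero_iff_forall_eq_int hn
    fun x : Fin n ↦ a (x.val : ZMod n)).1 hsum ⟨i.val, i.val_lt⟩ ⟨j.val, j.val_lt⟩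
  simpa using key

/-- The character sums of `f` and `g` multiply to the character sum of their correlation. -/
theorem sum_mul_addChar_neg_mul_sum_mul_addChar {G K : Type*} [AddCommGroup G] [Fintype G]
    [CommRing K] (ψ : AddChar G K) (f g : G → K) :
    (∑ i, f i * ψ (-i)) * ∑ i, g i * ψ i = ∑ k, (∑ i, f i * g (i + k)) * ψ k := by
  simp_rw [Finset.sum_mul]
  rw [Finset.sum_comm]
  refine Finset.sum_congr rfl fun i _ ↦ ?_
  rw [Finset.mul_sum, ← Equiv.sum_comp (Equiv.addLeft i)]
  refine Finset.sum_congr rfl fun k _ ↦ ?_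
  have hk : ψ k = ψ (-i) * ψ (i + k) := by
    rw [← AddChar.map_add_eq_mul, neg_add_cancel_left]
  rw [Equiv.coe_addLeft, hk]
  ring



/-- Let `n` be prime and `f, g : ℤ/nℤ → ℤ`, `A ∈ ℤ` with
`∑ i, f(i)·g(i+k) = A` for every `k`. Then `f` or `g` is constant. -/
theorem const_of_cyclic_correlation (n : ℕ) [NeZero n] (hn : n.Prime)
    (f g : ZMod n → ℤ) (A : ℤ)
    (h : ∀ k : ZMod n, ∑ i : ZMod n, f i * g (i + k) = A) :
    (∃ c : ℤ, ∀ i : ZMod n, f i = c) ∨ (∃ c : ℤ, ∀ i : ZMod n, g i = c) := by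
  have hψ := ZMod.injective_stdAddChar (N := n)
  have : Fact (1 < n) := ⟨hn.one_lt⟩
  have hne : ZMod.stdAddChar (N := n) ≠ 0 := fun h0 ↦
    one_ne_zero (hψ (by simp [h0] : ZMod.stdAddChar (1 : ZMod n) = ZMod.stdAddChar 0))
  have hprod := sum_mul_addChar_neg_mul_sum_mul_addChar (ZMod.stdAddChar (N := n))
    (fun i ↦ (f i : ℂ)) (fun i ↦ (g i : ℂ))
  have hA (k : ZMod n) : ∑ i, (f i : ℂ) * (g (i + k) : ℂ) = A := by exact_mod_cast h k
  simp_rw [hA] at hprod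
  rw [← Finset.mul_sum, AddChar.sum_eq_zero_iff_ne_zero.2 hne, mul_zero, mul_eq_zero] at hprod
  refine hprod.imp (fun hf ↦ ⟨f 0, fun i ↦ ?_⟩) fun hg ↦
    ⟨g 0, fun i ↦ forall_eq_of_sum_mul_addChar_eq_zero hn hψ hg i 0⟩
  rw [← Equiv.sum_comp (Equiv.neg (ZMod n))] at hf
  simp only [Equiv.neg_apply, neg_neg] at hf
  simpa using forall_eq_of_sum_mul_addChar_eq_zero (a := fun i ↦ f (-i)) hn hψ hf (-i) 0
end
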